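/- arXiv:2004.03550 — 2 statements merged into one kernel-verified Lean document; each statement's English description precedes it below -/
import Mathlib

section
/- Let C be the following collection of subsets of {1,...,10}: {1,2,6}, {1,3,9}, {1,4,5}, {1,7}, {1,8,10}, {2,3,7}, {2,4,10}, {2,5,9}, {2,8}, {3,4,8}, {3,5}, {3,6,10}, {4,6}, {4,7,9}, {5,6,7,8}, {5,10}, {6,9}, {7,10}, {8,9}, {9,10}. Then the group of all permutations τ of {1,...,10} such that the image under τ of every member of C is again a member of C is exactly the cyclic subgroup of order 4 of the symmetric group on {1,...,10} generated by the permutation σ = (1,2,3,4)(5,6,7,8)(9,10). -/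
/- The combinatorics `C` of the arrangements `M_i`: a collection of subsets of the
set of line indices.  We index the 10 lines by `Fin 10`, line `Lk` corresponding
to `(k-1 : Fin 10)`. -/
def C10 : Finset (Finset (Fin 10)) :=
  {{0, 1, 5},
   {0, 2, 8},
   {0, 3, 4},
   {0, 6},
   {0, 7, 9},
   {1, 2, 6},
   {1, 3, 9},
   {1, 4, 8},
   {1, 7},
   {2, 3, 7},
   {2, 4},
   {2, 5, 9},
   {3, 5},
   {3, 6, 8},
   {4, 5, 6, 7},
   {4, 9},
   {5, 8},
   {6, 9},
   {7, 8},
   {8, 9}}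

/-- The permutation `σ = (1,2,3,4)(5,6,7,8)(9,10)` (in `Fin 10`, 0-indexed). -/
def σ : Equiv.Perm (Fin 10) :=
  ⟨![1,2,3,0,5,6,7,4,9,8], ![3,0,1,2,7,4,5,6,9,8], by decide, by decide⟩


/-- Bit `m` of this number is set iff `m` is the bit mask of a member of `C10`. -/
def Kb (m : ℕ) : Bool := Nat.beq (Nat.land (Nat.shiftRight
  1552518092300708935148979488462502555266010898351941001576581711639846018307769988302574037113861187300665125086317351982371237248887002180535319246734731829134601674509415788799576241236206184508920390479227804974939581994744414208
  m) 1) 1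
def Pb (a b : Fin 10) : Bool := Kb (2 ^ a.val + 2 ^ b.val)
def Tb (a b c : Fin 10) : Bool := Kb (2 ^ a.val + (2 ^ b.val + 2 ^ c.val))

set_option maxRecDepth 100000

theorem Kb_of : ∀ s ∈ C10, Kb (∑ i ∈ s, 2 ^ i.val) = true := by
  simp only [C10, Finset.mem_insert, Finset.mem_singleton, forall_eq_or_imp, forall_eq]
  decide +kernel

theorem four_of : ∀ s ∈ C10, s.card = 4 → s = {4, 5, 6, 7} := by
  simp only [C10, Finset.mem_insert, Finset.mem_singleton, forall_eq_or_imp, forall_eq]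
  repeat' apply And.intro
  all_goals decide +kernel

set_option synthInstance.maxSize 100000 in
set_option synthInstance.maxHeartbeats 2000000 in
set_option maxHeartbeats 4000000 in
theorem search :
    ∀ x4 : Fin 10, (3 < x4.val ∧ x4.val < 8) → 
    ∀ x5 : Fin 10, (3 < x5.val ∧ x5.val < 8) → x4 ≠ x5 → 
    ∀ x6 : Fin 10, (3 < x6.val ∧ x6.val < 8) → x4 ≠ x6 → x5 ≠ x6 → 
    ∀ x7 : Fin 10, (3 < x7.val ∧ x7.val < 8) → x4 ≠ x7 → x5 ≠ x7 → x6 ≠ x7 → 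
    ∀ x0 : Fin 10, Pb x0 x6 = true → 
    ∀ x1 : Fin 10, Pb x1 x7 = true → Tb x0 x1 x5 = true → 
    ∀ x2 : Fin 10, Pb x2 x4 = true → Tb x1 x2 x6 = true → 
    ∀ x3 : Fin 10, Pb x3 x5 = true → Tb x0 x3 x4 = true → Tb x2 x3 x7 = true → 
    ∀ x9 : Fin 10, Pb x4 x9 = true → Pb x6 x9 = true → Tb x0 x7 x9 = true → Tb x1 x3 x9 = true → Tb x2 x5 x9 = true → 
    ∀ x8 : Fin 10, Pb x5 x8 = true → Pb x7 x8 = true → Pb x8 x9 = true → Tb x0 x2 x8 = true → Tb x1 x4 x8 = true → Tb x3 x6 x8 = true → 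
    (x0 = 0 ∧ x1 = 1 ∧ x2 = 2 ∧ x3 = 3 ∧ x4 = 4 ∧ x5 = 5 ∧ x6 = 6 ∧ x7 = 7 ∧ x8 = 8 ∧ x9 = 9) ∨
    (x0 = 1 ∧ x1 = 2 ∧ x2 = 3 ∧ x3 = 0 ∧ x4 = 5 ∧ x5 = 6 ∧ x6 = 7 ∧ x7 = 4 ∧ x8 = 9 ∧ x9 = 8) ∨
    (x0 = 2 ∧ x1 = 3 ∧ x2 = 0 ∧ x3 = 1 ∧ x4 = 6 ∧ x5 = 7 ∧ x6 = 4 ∧ x7 = 5 ∧ x8 = 8 ∧ x9 = 9) ∨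
    (x0 = 3 ∧ x1 = 0 ∧ x2 = 1 ∧ x3 = 2 ∧ x4 = 7 ∧ x5 = 4 ∧ x6 = 5 ∧ x7 = 6 ∧ x8 = 9 ∧ x9 = 8) := by
  decide +kernel

theorem σ_ord : orderOf σ = 4 := by
  have h : orderOf σ = 2 ^ (1 + 1) :=
    orderOf_eq_prime_pow (by decide +kernel) (by decide +kernel)
  simpa using h

theorem statement0 :
    {τ : Equiv.Perm (Fin 10) | ∀ s ∈ C10, s.image τ ∈ C10}
      = (Subgroup.zpowers σ : Subgroup (Equiv.Perm (Fin 10))) ∧ orderOf σ = 4 := by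
  refine ⟨?_, σ_ord⟩
  ext τ
  simp only [Set.mem_ofPred_eq, SetLike.mem_coe]
  constructor
  · intro h
    have hn : ∀ a b : Fin 10, a ≠ b → τ a ≠ τ b := fun a b hab e => hab (τ.injective e)
    have hK : ∀ s ∈ C10, Kb (∑ i ∈ s, 2 ^ (τ i).val) = true := by
      intro s hs
      have h1 := Kb_of _ (h s hs)
      rwa [Finset.sum_image (fun x _ y _ e => τ.injective e)] at h1
    have hP : ∀ a b : Fin 10, (a ≠ b ∧ ({a, b} : Finset (Fin 10)) ∈ C10) →
        Pb (τ a) (τ b) = true := by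
      rintro a b ⟨h1, h2⟩
      have h3 := hK _ h2
      rwa [Finset.sum_pair h1] at h3
    have hT : ∀ a b c : Fin 10,
        (a ∉ ({b, c} : Finset (Fin 10)) ∧ b ≠ c ∧ ({a, b, c} : Finset (Fin 10)) ∈ C10) →
        Tb (τ a) (τ b) (τ c) = true := by
      rintro a b c ⟨h1, h2, h3⟩
      have h4 := hK _ h3
      rwa [Finset.sum_insert h1, Finset.sum_pair h2] at h4
    have h4 : ({4, 5, 6, 7} : Finset (Fin 10)).image τ = {4, 5, 6, 7} := by
      apply four_of _ (h _ (by decide))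
      rw [Finset.card_image_of_injective _ τ.injective]
      rfl
    have hQ : ∀ a : Fin 10, a ∈ ({4, 5, 6, 7} : Finset (Fin 10)) →
        (3 < (τ a).val ∧ (τ a).val < 8) := by
      intro a ha
      have h5 : τ a ∈ ({4, 5, 6, 7} : Finset (Fin 10)) := by
        rw [← h4]
        exact Finset.mem_image_of_mem _ ha
      generalize τ a = y at h5
      revert y
      decide
    have key := search (τ 4) (hQ 4 (by decide)) (τ 5) (hQ 5 (by decide)) (hn 4 5 (by decide)) (τ 6) (hQ 6 (by decide)) (hn 4 6 (by decide)) (hn 5 6 (by decide)) (τ 7) (hQ 7 (by decide)) (hn 4 7 (by decide)) (hn 5 7 (by decide)) (hn 6 7 (by decide)) (τ 0) (hP 0 6 (by decide)) (τ 1) (hP 1 7 (by decide)) (hT 0 1 5 (by decide)) (τ 2) (hP 2 4 (by decide)) (hT 1 2 6 (by decide)) (τ 3) (hP 3 5 (by decide)) (hT 0 3 4 (by decide)) (hT 2 3 7 (by decide)) (τ 9) (hP 4 9 (by decide)) (hP 6 9 (by decide)) (hT 0 7 9 (by decide)) (hT 1 3 9 (by decide)) (hT 2 5 9 (by decide)) (τ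 8) (hP 5 8 (by decide)) (hP 7 8 (by decide)) (hP 8 9 (by decide)) (hT 0 2 8 (by decide)) (hT 1 4 8 (by decide)) (hT 3 6 8 (by decide))
    rw [Subgroup.mem_zpowers_iff]
    rcases key with k | k | k | k
    · refine ⟨0, ?_⟩
      ext i
      obtain ⟨k0, k1, k2, k3, k4, k5, k6, k7, k8, k9⟩ := k
      fin_cases i <;> simp [*]
    · refine ⟨1, ?_⟩
      ext i
      obtain ⟨k0, k1, k2, k3, k4, k5, k6, k7, k8, k9⟩ := k
      fin_cases i <;> simp [*] <;> decide
    · refine ⟨2, ?_⟩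
      ext i
      obtain ⟨k0, k1, k2, k3, k4, k5, k6, k7, k8, k9⟩ := k
      fin_cases i <;> simp [*] <;> decide
    · refine ⟨3, ?_⟩
      ext i
      obtain ⟨k0, k1, k2, k3, k4, k5, k6, k7, k8, k9⟩ := k
      fin_cases i <;> simp [*] <;> decide
  · intro h
    rw [mem_zpowers_iff_mem_range_orderOf, σ_ord] at h
    obtain ⟨k, hk, rfl⟩ := Finset.mem_image.mp h
    clear h hk
    have h1 : ∀ s ∈ C10, s.image σ ∈ C10 := by
      simp only [C10, Finset.mem_insert, Finset.mem_singleton, forall_eq_or_imp, forall_eq]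
      repeat' apply And.intro
      all_goals decide +kernel
    induction k with
    | zero => intro s hs; simpa using hs
    | succ k ih =>
      intro s hs
      have h2 := h1 _ (ih s hs)
      rw [Finset.image_image] at h2
      rw [pow_succ']
      exact h2
end

section
/- Let i ≠ j ∈ {1,2,3,4} with i + j ≢ 0 (mod 5). Then there is no homeomorphism h of ℂℙ² onto itself such that h maps the line L_k of the arrangement M_i onto the line L_k of the arrangement M_j for every k ∈ {1,...,10}; that is, M_i and M_j form an ordered Zariski pair. -/
/- The complex projective plane `ℂℙ²`, with its quotient topology, and projective
lines given as zero loci of linear forms in the homogeneous coordinates. -/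

open scoped LinearAlgebra.Projectivization
open Projectivization

noncomputable section

abbrev CP2 := ℙ ℂ (Fin 3 → ℂ)

instance : TopologicalSpace CP2 :=
  inferInstanceAs (TopologicalSpace (Quotient (projectivizationSetoid ℂ (Fin 3 → ℂ))))

/-- The projective line `{[x:y:z] | a*x + b*y + c*z = 0}`.  (The zero locus of a linear
form is well defined on any representative, so we may use the representative `p.rep`.) -/
def projLine (a b c : ℂ) : Set CP2 :=
  {p | a * p.rep 0 + b * p.rep 1 + c * p.rep 2 = 0}

/-- The lines of the arrangement `M_i`, where `α = ζ^i`: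
`L1: z=0`, `L2: x=0`, `L3: (α²+α)x−(α+1)y+z=0`, `L4: y=0`, `L5: y−z=0`, `L6: x−z=0`,
`L7: αx−(α+1)y+z=0`, `L8: (α²+α)x−(α²+α+1)y+z=0`, `L9: αx−y+z=0`, `L10: α³x+y=0`. -/
def Mline (α : ℂ) : Fin 10 → Set CP2 :=
  ![projLine 0 0 1,
    projLine 1 0 0,
    projLine (α^2 + α) (-(α + 1)) 1,
    projLine 0 1 0,
    projLine 0 1 (-1),
    projLine 1 0 (-1),
    projLine α (-(α + 1)) 1,
    projLine (α^2 + α) (-(α^2 + α + 1)) 1,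
    projLine α (-1) 1,
    projLine (α^3) 1 0]

section Aux
open Topology Filter Set

theorem exists_log_of_convex {E : Type*} [NormedAddCommGroup E] [NormedSpace ℝ E]
    {C : Set E} (hC : Convex ℝ C) (hne : C.Nonempty) {G : E → ℂ}
    (hG : ContinuousOn G C) (h0 : ∀ x ∈ C, G x ≠ 0) :
    ∃ g : E → ℂ, ContinuousOn g C ∧ ∀ x ∈ C, Complex.exp (g x) = G x := by
  classical
  have := hC.contractibleSpace hne
  have := hC.locallyPathConnectedSpace
  obtain ⟨x0, hx0⟩ := hne
  obtain ⟨F, ⟨-, hF⟩, -⟩ := Complex.isCoveringMapOn_exp.existsUnique_continuousMap_lifts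
    (A := C) (⟨fun x => G x, hG.domRestrict⟩ : C(C, ℂ)) (a₀ := ⟨x0, hx0⟩)
    (e₀ := Complex.log (G x0)) (Complex.exp_log (h0 _ hx0))
    (fun a => h0 _ a.2)
  refine ⟨fun x => if hx : x ∈ C then F ⟨x, hx⟩ else 0, ?_, ?_⟩
  · rw [continuousOn_iff_continuous_domRestrict]
    convert F.continuous using 1
    ext x
    simp
  · intro x hx
    simp only [hx, dif_pos]
    exact congrFun hF ⟨x, hx⟩

theorem const_of_exp {A : Type*} [TopologicalSpace A] {s : Set A} (hs : IsPreconnected s)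
    {f : A → ℂ} (hf : ContinuousOn f s) {c : ℂ} (hc : ∀ x ∈ s, Complex.exp (f x) = c)
    {x y : A} (hx : x ∈ s) (hy : y ∈ s) : f x = f y := by
  refine Complex.isCoveringMap_exp.constOn_of_comp hs hf ?_ hx hy
  intro a ha a' ha'
  simp [hc a ha, hc a' ha']

theorem preconn_diff_finite {T : Set ℂ} (hT : IsOpen T) (hc : Convex ℝ T) {F : Set ℂ}
    (hF : F.Finite) (h0 : (0:ℂ) ∈ T \ F) (h1 : (1:ℂ) ∈ T \ F) :
    ∃ σ : ℝ → ℂ, Continuous σ ∧ σ 0 = 0 ∧ σ 1 = 1 ∧ ∀ s ∈ Icc (0:ℝ) 1, σ s ∈ T \ F := by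
  have hseg : ∀ s ∈ Icc (0:ℝ) 1, (s:ℂ) ∈ T := by
    intro s hs
    have := hc h0.1 h1.1 (a := 1 - s) (b := s) (by linarith [hs.2]) hs.1 (by ring)
    simpa using this
  have hK : IsCompact ((fun s : ℝ => (s:ℂ)) '' Icc 0 1) :=
    isCompact_Icc.image Complex.continuous_ofReal
  obtain ⟨ε, hε, hsub⟩ := hK.exists_thickening_subset_open hT
    (by rintro _ ⟨s, hs, rfl⟩; exact hseg s hs)
  have hbad : ((fun f : ℂ => f.im / (f.re * (1 - f.re))) '' F).Finite := hF.image _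
  obtain ⟨c, hcI, hcb⟩ := (Ioo_infinite hε).exists_notMem_finite hbad
  refine ⟨fun s => s + Complex.I * (c * (s * (1 - s)) : ℝ), by fun_prop, by simp, by simp, ?_⟩
  intro s hs
  constructor
  · apply hsub
    rw [Metric.mem_thickening_iff]
    refine ⟨s, ⟨s, hs, rfl⟩, ?_⟩
    rw [dist_eq_norm, add_sub_cancel_left, norm_mul, Complex.norm_I, one_mul, Complex.norm_real,
      Real.norm_eq_abs, abs_lt]
    have h1 : 0 ≤ s * (1 - s) := mul_nonneg hs.1 (by linarith [hs.2])
    have h2 : s * (1 - s) ≤ 1 := by nlinarith [hs.1, hs.2]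
    have := hcI.1; have := hcI.2
    constructor <;> nlinarith
  · intro hmem
    rcases eq_or_lt_of_le hs.1 with h | h
    · subst h; simp at hmem; exact h0.2 hmem
    rcases eq_or_lt_of_le hs.2 with h' | h'
    · subst h'; simp at hmem; exact h1.2 hmem
    apply hcb
    refine ⟨_, hmem, ?_⟩
    have : s * (1 - s) ≠ 0 := (mul_pos h (by linarith)).ne'
    have hre : ((s:ℂ) + Complex.I * (c * (s * (1 - s)) : ℝ)).re = s := by
      rw [Complex.add_re, Complex.I_mul_re, Complex.ofReal_im, Complex.ofReal_re]; simp
    have him : ((s:ℂ) + Complex.I * (c * (s * (1 - s)) : ℝ)).im = c * (s * (1 - s)) := by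
      rw [Complex.add_im, Complex.I_mul_im, Complex.ofReal_im, Complex.ofReal_re]; simp
    simp only [hre, him]
    field_simp

section
variable {E : Type*} [NormedAddCommGroup E] [NormedSpace ℂ E] {ι : Type*} [Finite ι]

def Acompl (m : ι → E →L[ℂ] ℂ) : Set E := {w | ∀ a, m a w ≠ 0}

theorem isOpen_Acompl (m : ι → E →L[ℂ] ℂ) : IsOpen (Acompl m) := by
  have : Acompl m = ⋂ a, {w | m a w ≠ 0} := by ext; simp [Acompl]
  rw [this]
  exact isOpen_iInter_of_finite fun a => isOpen_ne_fun (m a).continuous continuous_const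

theorem slice_finite (m : ι → E →L[ℂ] ℂ) {x : E} (hx : x ∈ Acompl m) (u : E) :
    {t : ℂ | x + t • u ∉ Acompl m}.Finite := by
  have : {t : ℂ | x + t • u ∉ Acompl m} ⊆ Set.range (fun a => - m a x / m a u) := by
    intro t ht
    simp only [Acompl, mem_ofPred_eq, not_forall, not_not] at ht
    obtain ⟨a, ha⟩ := ht
    refine ⟨a, ?_⟩
    simp only [map_add, map_smul, smul_eq_mul] at ha
    have hu : m a u ≠ 0 := by
      intro h; rw [h] at ha; exact hx a (by simpa using ha)
    simp only
    field_simp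
    linear_combination -ha
  exact (Set.finite_range _).subset this

theorem preconn_inter {B : Set E} (hB : IsOpen B) (hc : ∀ x ∈ B, ∀ y ∈ B,
      Convex ℝ {t : ℂ | x + t • (y - x) ∈ B}) (m : ι → E →L[ℂ] ℂ) :
    IsPreconnected (B ∩ Acompl m) := by
  apply isPreconnected_of_forall_pair
  intro x hx y hy
  obtain ⟨σ, hσ, h0, h1, hσm⟩ := preconn_diff_finite (T := {t : ℂ | x + t • (y - x) ∈ B})
    (hB.preimage (by fun_prop)) (hc x hx.1 y hy.1) (slice_finite m hx.2 (y - x))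
    ⟨by simpa using hx.1, by simpa using hx.2⟩ ⟨by simpa using hy.1, by simpa using hy.2⟩
  refine ⟨(fun s => x + σ s • (y - x)) '' Icc 0 1, ?_, ⟨0, by simp, by simp [h0]⟩,
    ⟨1, by simp, by simp [h1]⟩, ?_⟩
  · rintro _ ⟨s, hs, rfl⟩
    have := hσm s hs
    exact ⟨this.1, by simpa using this.2⟩
  · exact isPreconnected_Icc.image _ (by fun_prop)

theorem preconn_Acompl (m : ι → E →L[ℂ] ℂ) : IsPreconnected (Acompl m) := by
  have := preconn_inter (B := univ) isOpen_univ (by simp [convex_univ]) m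
  simpa using this

theorem preconn_ball_inter (v : E) (r : ℝ) (m : ι → E →L[ℂ] ℂ) :
    IsPreconnected (Metric.ball v r ∩ Acompl m) := by
  let := NormedSpace.complexToReal (E := E)
  apply preconn_inter Metric.isOpen_ball
  intro x _ y _ s hs t ht a b ha hb hab
  have := convex_ball v r hs ht ha hb hab
  simp only [mem_ofPred_eq]
  convert this using 1
  have hab' : x = (a + b) • x := by rw [hab, one_smul]
  nth_rw 1 [hab']
  simp only [add_smul, smul_add, smul_assoc]
  abel

theorem dense_Acompl [BaireSpace E] {m : ι → E →L[ℂ] ℂ} (hm : ∀ a, m a ≠ 0) : Dense (Acompl m) := by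
  have : Acompl m = ⋂ a, {w | m a w ≠ 0} := by ext; simp [Acompl]
  rw [this]
  have := Fintype.ofFinite ι
  refine dense_iInter_of_isOpen (fun a => isOpen_ne_fun (m a).continuous continuous_const) ?_
  intro a
  have hmap : IsOpenMap (m a) := by
    refine (m a).isOpenMap_of_ne_zero (hm a)
  exact (dense_compl_singleton (0:ℂ)).preimage hmap

end

theorem extend_log {E : Type*} [NormedAddCommGroup E] [NormedSpace ℂ E] {ι : Type*} [Finite ι]
    {m : ι → E →L[ℂ] ℂ} (hd : Dense (Acompl m)) {B : Set E} (hB : IsOpen B) {Φ g : E → ℂ}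
    (hΦ : ContinuousOn Φ B) (h0 : ∀ v ∈ B, Φ v ≠ 0) (hg : ContinuousOn g (Acompl m))
    (he : ∀ w ∈ Acompl m, w ∈ B → Complex.exp (g w) = Φ w) :
    ContinuousOn (extendFrom (Acompl m) g) B ∧
    ∀ v ∈ B, Tendsto g (𝓝[Acompl m] v) (𝓝 (extendFrom (Acompl m) g v)) ∧
      Complex.exp (extendFrom (Acompl m) g v) = Φ v := by
  let := NormedSpace.complexToReal (E := E)
  have key : ∀ v ∈ B, ∃ y, Tendsto g (𝓝[Acompl m] v) (𝓝 y) := by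
    intro v hv
    obtain ⟨r, hr, hrB⟩ := Metric.isOpen_iff.1 hB v hv
    obtain ⟨φ, hφ, hφe⟩ := exists_log_of_convex (convex_ball v r) ⟨v, Metric.mem_ball_self hr⟩
      (hΦ.mono hrB) (fun x hx => h0 x (hrB hx))
    obtain ⟨w, hwb, hwA⟩ := hd.inter_open_nonempty _ Metric.isOpen_ball
      ⟨v, Metric.mem_ball_self hr⟩
    have hc : ∀ x ∈ Metric.ball v r ∩ Acompl m, g x = φ x + (g w - φ w) := by
      intro x hx
      have := const_of_exp (preconn_ball_inter v r m) (f := fun x => g x - φ x) (c := 1)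
        ((hg.mono inter_subset_right).sub (hφ.mono inter_subset_left))
        (by
          intro x hx
          rw [Complex.exp_sub, he x hx.2 (hrB hx.1), hφe x hx.1]
          exact div_self (h0 x (hrB hx.1))) hx ⟨hwb, hwA⟩
      linear_combination this
    refine ⟨φ v + (g w - φ w), ?_⟩
    have hφv : ContinuousAt φ v := hφ.continuousAt (Metric.ball_mem_nhds v hr)
    have ht : Tendsto (fun x => φ x + (g w - φ w)) (𝓝[Acompl m] v) (𝓝 (φ v + (g w - φ w))) :=
      (hφv.tendsto.mono_left nhdsWithin_le_nhds).add_const _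
    refine ht.congr' ?_
    have h1 : ∀ᶠ x in 𝓝[Acompl m] v, x ∈ Metric.ball v r :=
      nhdsWithin_le_nhds (Metric.ball_mem_nhds v hr)
    filter_upwards [h1, self_mem_nhdsWithin] with x hx hxA
    exact (hc x ⟨hx, hxA⟩).symm
  refine ⟨continuousOn_extendFrom (fun v _ => hd v) key, fun v hv => ?_⟩
  have ht := tendsto_extendFrom (key v hv)
  refine ⟨ht, ?_⟩
  have : (𝓝[Acompl m] v).NeBot := mem_closure_iff_nhdsWithin_neBot.1 (hd v)
  have h1 := (Complex.continuous_exp.tendsto _).comp ht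
  have h2 : Tendsto Φ (𝓝[Acompl m] v) (𝓝 (Φ v)) :=
    (hΦ.continuousAt (hB.mem_nhds hv)).tendsto.mono_left nhdsWithin_le_nhds
  refine tendsto_nhds_unique h1 (h2.congr' ?_)
  have h3 : ∀ᶠ x in 𝓝[Acompl m] v, x ∈ B := nhdsWithin_le_nhds (hB.mem_nhds hv)
  filter_upwards [h3, self_mem_nhdsWithin] with x hx hxA
  exact (he x hxA hx).symm

section LL
variable {E : Type*} [TopologicalSpace E]

def LL (U : Set E) (G : E → ℂ) (q : E) : Prop :=
  ∃ N ∈ 𝓝 q, ∃ g : E → ℂ, ContinuousOn g (N ∩ U) ∧ ∀ v ∈ N ∩ U, Complex.exp (g v) = G v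

theorem LL.mul {U : Set E} {G G' : E → ℂ} {q : E} (h : LL U G q) (h' : LL U G' q) :
    LL U (fun v => G v * G' v) q := by
  obtain ⟨N, hN, g, hg, he⟩ := h
  obtain ⟨N', hN', g', hg', he'⟩ := h'
  refine ⟨N ∩ N', inter_mem hN hN', fun v => g v + g' v,
    (hg.mono fun x hx => ⟨hx.1.1, hx.2⟩).add (hg'.mono fun x hx => ⟨hx.1.2, hx.2⟩), ?_⟩
  intro v hv
  rw [Complex.exp_add, he v ⟨hv.1.1, hv.2⟩, he' v ⟨hv.1.2, hv.2⟩]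

theorem LL.inv {U : Set E} {G : E → ℂ} {q : E} (h : LL U G q) :
    LL U (fun v => (G v)⁻¹) q := by
  obtain ⟨N, hN, g, hg, he⟩ := h
  refine ⟨N, hN, fun v => - g v, hg.neg, ?_⟩
  intro v hv
  rw [Complex.exp_neg, he v hv]

theorem LL.congr {U : Set E} {G G' : E → ℂ} {q : E} (h : LL U G q) (hG : ∀ v ∈ U, G v = G' v) :
    LL U G' q := by
  obtain ⟨N, hN, g, hg, he⟩ := h
  exact ⟨N, hN, g, hg, fun v hv => (he v hv).trans (hG v hv.2)⟩

theorem LL.eventually {U : Set E} {G : E → ℂ} {q : E} (h : LL U G q) :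
    ∀ᶠ p in 𝓝 q, LL U G p := by
  obtain ⟨N, hN, g, hg, he⟩ := h
  filter_upwards [eventually_mem_nhds_iff.2 hN] with p hp
  exact ⟨N, hp, g, hg, he⟩

theorem LL.of_log {U : Set E} {G g : E → ℂ} {q : E} (hg : ContinuousOn g U)
    (he : ∀ v ∈ U, Complex.exp (g v) = G v) : LL U G q :=
  ⟨univ, univ_mem, g, by simpa using hg, by simpa using he⟩

theorem LL.of_cont {U : Set E} {G : E → ℂ} {q : E} {N : Set E} (hN : N ∈ 𝓝 q)
    (hG : ContinuousOn G N) (h0 : G q ≠ 0) : LL U G q := by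
  have hc : ContinuousAt (fun v => G v / G q) q := (hG.continuousAt hN).div_const _
  have hs : ∀ᶠ v in 𝓝 q, G v / G q ∈ Complex.slitPlane := by
    apply hc.eventually_mem
    rw [div_self h0]
    exact Complex.isOpen_slitPlane.mem_nhds Complex.one_mem_slitPlane
  refine ⟨N ∩ {v | G v / G q ∈ Complex.slitPlane}, inter_mem hN hs,
    fun v => Complex.log (G v / G q) + Complex.log (G q), ?_, ?_⟩
  · refine ContinuousOn.add (ContinuousOn.clog ?_ fun v hv => hv.1.2) continuousOn_const
    exact (hG.mono fun v hv => hv.1.1).div_const _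
  · intro v hv
    have : G v / G q ≠ 0 := Complex.slitPlane_ne_zero hv.1.2
    rw [Complex.exp_add, Complex.exp_log this, Complex.exp_log h0, div_mul_cancel₀ _ h0]

theorem LL.comp {E' : Type*} [TopologicalSpace E'] {U : Set E} {U' : Set E'} {G : E → ℂ}
    {f : E' → E} (hf : Continuous f) {q : E'} (h : LL U G (f q)) (hU : ∀ x ∈ U', f x ∈ U) :
    LL U' (fun x => G (f x)) q := by
  obtain ⟨N, hN, g, hg, he⟩ := h
  exact ⟨f ⁻¹' N, hf.continuousAt hN, fun x => g (f x),
    hg.comp hf.continuousOn (fun x hx => ⟨hx.1, hU x hx.2⟩), fun x hx => he _ ⟨hx.1, hU x hx.2⟩⟩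
end LL

theorem planar_log {S : Set ℂ} (hS : S.Finite) : ∀ {G : ℂ → ℂ}, ContinuousOn G Sᶜ →
    (∀ t ∉ S, G t ≠ 0) → (∀ s ∈ S, LL Sᶜ G s) →
    ∃ g : ℂ → ℂ, ContinuousOn g Sᶜ ∧ ∀ t ∉ S, Complex.exp (g t) = G t := by
  induction S, hS using Set.Finite.induction_on with
  | empty =>
    intro G hG h0 _
    obtain ⟨g, hg, he⟩ := exists_log_of_convex (convex_univ (𝕜 := ℝ) (E := ℂ)) ⟨0, trivial⟩
      (by simpa using hG) (fun x _ => h0 x (by simp))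
    exact ⟨g, by simpa using hg, fun t _ => he t trivial⟩
  | @insert a S ha hS ih =>
    intro G hG h0 hl
    obtain ⟨N, hN, g, hg, he⟩ := hl a (mem_insert _ _)
    have hSo : IsOpen Sᶜ := hS.isClosed.isOpen_compl
    have hSo' : IsOpen (insert a S)ᶜ := (hS.insert a).isClosed.isOpen_compl
    obtain ⟨R, hR, hRN⟩ := Metric.mem_nhds_iff.1 (inter_mem hN (hSo.mem_nhds ha))
    let ρ : ℂ → ℝ := fun t => max 0 (min 1 (2 - 3 * dist t a / R))
    have hρ : Continuous ρ := by fun_prop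
    let ψ : ℂ → ℂ := fun t => by classical exact if t ∈ Metric.ball a R then ρ t * g t else 0
    have hsub : ∀ t ∈ Metric.ball a R, t ≠ a → t ∈ N ∩ (insert a S)ᶜ := fun t ht hta =>
      ⟨(hRN ht).1, by simp only [mem_compl_iff, mem_insert_iff, not_or]; exact ⟨hta, (hRN ht).2⟩⟩
    have hψ : ∀ t, t ≠ a → ContinuousAt ψ t := by
      intro t hta
      by_cases hb : t ∈ Metric.ball a R
      · have ho : Metric.ball a R ∩ {a}ᶜ ∈ 𝓝 t :=
          (Metric.isOpen_ball.inter isOpen_compl_singleton).mem_nhds ⟨hb, hta⟩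
        have h1 : ContinuousAt g t :=
          (hg.mono (fun x hx => hsub x hx.1 hx.2)).continuousAt ho
        have h2 : ContinuousAt (fun x => (ρ x : ℂ) * g x) t := by fun_prop
        refine h2.congr ?_
        filter_upwards [ho] with x hx
        simp only [ψ, if_pos hx.1]
      · have h1 : ∀ᶠ x in 𝓝 t, 2 * R / 3 < dist x a := by
          have : ContinuousAt (fun x => dist x a) t := by fun_prop
          refine this.eventually_const_lt ?_
          simp only [Metric.mem_ball, not_lt] at hb
          linarith
        refine (continuousAt_const (y := (0:ℂ))).congr ?_
        filter_upwards [h1] with x hx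
        have : ρ x = 0 := by
          simp only [ρ]
          apply max_eq_left
          refine (min_le_right _ _).trans ?_
          rw [sub_nonpos, le_div_iff₀ hR]; linarith
        simp [ψ, this]
    have hψa : ∀ᶠ t in 𝓝 a, t ≠ a → G t * Complex.exp (- ψ t) = 1 := by
      filter_upwards [Metric.ball_mem_nhds a (show 0 < R / 3 by positivity)] with t ht hta
      have ht' : t ∈ Metric.ball a R := Metric.ball_subset_ball (by linarith) ht
      have h1 : ρ t = 1 := by
        simp only [ρ]
        rw [min_eq_left, max_eq_right zero_le_one]
        rw [Metric.mem_ball] at ht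
        have : 3 * dist t a / R ≤ 1 := by rw [div_le_one hR]; linarith
        linarith
      have h2 : ψ t = g t := by simp only [ψ, if_pos ht', h1]; simp
      rw [h2, Complex.exp_neg, he t (hsub t ht' hta)]
      exact mul_inv_cancel₀ (h0 t (hsub t ht' hta).2)
    let G' : ℂ → ℂ := fun t => by classical exact if t = a then 1 else G t * Complex.exp (- ψ t)
    have hG' : ∀ t, t ≠ a → G' t = G t * Complex.exp (- ψ t) := fun t ht => by simp [G', ht]
    have hmem : ∀ t, t ≠ a → t ∉ S → t ∈ (insert a S)ᶜ := fun t h1 h2 => by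
      simp [h1, h2]
    obtain ⟨g', hg', he'⟩ := ih (G := G') (by
        intro t ht
        apply ContinuousAt.continuousWithinAt
        by_cases hta : t = a
        · subst hta
          refine (continuousAt_const (y := (1:ℂ))).congr ?_
          filter_upwards [hψa] with x hx
          by_cases hxa : x = t
          · simp [G', hxa]
          · rw [hG' x hxa, hx hxa]
        · have h1 : ContinuousAt G t := hG.continuousAt (hSo'.mem_nhds (hmem t hta ht))
          have h3 := hψ t hta
          have h2 : ContinuousAt (fun x => G x * Complex.exp (- ψ x)) t :=
            h1.mul (Complex.continuous_exp.continuousAt.comp h3.neg)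
          refine h2.congr ?_
          filter_upwards [isOpen_compl_singleton.mem_nhds (show t ∈ ({a}:Set ℂ)ᶜ from hta)] with x hx
          exact (hG' x hx).symm)
      (by
        intro t ht
        by_cases hta : t = a
        · simp [G', hta]
        · rw [hG' t hta]
          exact mul_ne_zero (h0 t (hmem t hta ht)) (Complex.exp_ne_zero _))
      (by
        intro s hs
        obtain ⟨M, hM, k, hk, hke⟩ := hl s (mem_insert_of_mem _ hs)
        have hsa : s ≠ a := fun h => ha (h ▸ hs)
        refine ⟨M ∩ {a}ᶜ, inter_mem hM (isOpen_compl_singleton.mem_nhds hsa),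
          fun t => k t - ψ t, ?_, ?_⟩
        · exact (hk.mono fun t ht => ⟨ht.1.1, hmem t ht.1.2 ht.2⟩).sub
            fun t ht => (hψ t ht.1.2).continuousWithinAt
        · intro t ht
          simp only []
          rw [hG' t ht.1.2, sub_eq_add_neg, Complex.exp_add, hke t ⟨ht.1.1, hmem t ht.1.2 ht.2⟩])
    refine ⟨fun t => g' t + ψ t, ?_, ?_⟩
    · refine (hg'.mono (compl_subset_compl.2 (subset_insert _ _))).add fun t ht =>
        (hψ t ?_).continuousWithinAt
      rintro rfl; exact ht (mem_insert _ _)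
    · intro t ht
      simp only [mem_insert_iff, not_or] at ht
      rw [Complex.exp_add, he' t ht.2, hG' t ht.1, mul_assoc, ← Complex.exp_add]
      simp

section
variable {E : Type*} [NormedAddCommGroup E] [NormedSpace ℂ E] {ι : Type*} [Finite ι]

def Gen (m : ι → E →L[ℂ] ℂ) (k : ι) : Set E := {q | m k q = 0 ∧ ∀ a, a ≠ k → m a q ≠ 0}

theorem others_nhds {m : ι → E →L[ℂ] ℂ} {k : ι} {q : E} (hq : q ∈ Gen m k) :
    {v | ∀ a, a ≠ k → m a v ≠ 0} ∈ 𝓝 q := by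
  have : {v | ∀ a, a ≠ k → m a v ≠ 0} = Acompl (fun a : {a // a ≠ k} => m a.1) := by
    ext v; simp [Acompl]
  rw [this]
  exact (isOpen_Acompl _).mem_nhds fun a => hq.2 a.1 a.2

theorem exists_one {f : E →L[ℂ] ℂ} (hf : f ≠ 0) : ∃ e, f e = 1 := by
  obtain ⟨e, he⟩ : ∃ e, f e ≠ 0 := by
    by_contra! h; exact hf (ContinuousLinearMap.ext h)
  exact ⟨(f e)⁻¹ • e, by simp [he]⟩

theorem exists_winding {m : ι → E →L[ℂ] ℂ} {k : ι} (hk : m k ≠ 0) {q : E} (hq : q ∈ Gen m k)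
    {F : E → ℂ} (hF : ContinuousOn F (Acompl m)) (h0 : ∀ v ∈ Acompl m, F v ≠ 0) :
    ∃ n : ℤ, LL (Acompl m) (fun v => F v * (m k v) ^ (-n)) q := by
  let := NormedSpace.complexToReal (E := E)
  obtain ⟨e, he⟩ := exists_one hk
  have hcont : Continuous (fun p : ℂ × E => p.2 + (p.1 - m k p.2) • e) := by fun_prop
  have h1 : (fun p : ℂ × E => p.2 + (p.1 - m k p.2) • e) ⁻¹' {v | ∀ a, a ≠ k → m a v ≠ 0}
      ∈ 𝓝 ((0:ℂ), q) := by
    apply hcont.continuousAt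
    have : q + ((0:ℂ) - m k q) • e = q := by simp [hq.1]
    simp only [this]; exact others_nhds hq
  obtain ⟨δ, hδ, hball⟩ := Metric.mem_nhds_iff.1 h1
  have hU : ∀ z : ℂ, ∀ v ∈ Metric.ball q δ, z ≠ 0 → ‖z‖ < δ → v + (z - m k v) • e ∈ Acompl m := by
    intro z v hv hz hzδ a
    by_cases hak : a = k
    · subst hak; simpa [he] using hz
    · have : (z, v) ∈ Metric.ball ((0:ℂ), q) δ := by
        rw [← ball_prod_same]; exact ⟨by simpa using hzδ, hv⟩
      exact hball this a hak
  let C : Set (ℂ × E) := {w : ℂ | w.re < Real.log δ} ×ˢ Metric.ball q δ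
  have hC : Convex ℝ C := (convex_halfSpace_re_lt _).prod (convex_ball q δ)
  have hexp : ∀ w : ℂ, w.re < Real.log δ → ‖Complex.exp w‖ < δ := by
    intro w hw
    rw [Complex.norm_exp, ← Real.lt_log_iff_exp_lt hδ]; exact hw
  have hCU : ∀ p ∈ C, p.2 + (Complex.exp p.1 - m k p.2) • e ∈ Acompl m := fun p hp =>
    hU _ _ hp.2 (Complex.exp_ne_zero _) (hexp _ hp.1)
  have hCne : C.Nonempty := ⟨(((Real.log δ - 1 : ℝ) : ℂ), q), by simp, by simpa using hδ⟩
  obtain ⟨Λ, hΛ, hΛe⟩ := exists_log_of_convex hC hCne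
    (G := fun p => F (p.2 + (Complex.exp p.1 - m k p.2) • e))
    (hF.comp (by fun_prop) hCU) (fun p hp => h0 _ (hCU p hp))
  have hsh : ∀ p ∈ C, (p.1 + 2 * Real.pi * Complex.I, p.2) ∈ C := by
    intro p hp
    refine ⟨?_, hp.2⟩
    have := hp.1
    simp only [mem_ofPred_eq] at this ⊢
    simpa using this
  have hdiff : ∀ p ∈ C, Complex.exp (Λ (p.1 + 2 * Real.pi * Complex.I, p.2) - Λ p) = 1 := by
    intro p hp
    rw [Complex.exp_sub, hΛe _ (hsh p hp), hΛe _ hp]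
    simp only [Complex.exp_periodic p.1]
    exact div_self (h0 _ (hCU p hp))
  obtain ⟨p0, hp0⟩ := hCne
  obtain ⟨n, hn⟩ := Complex.exp_eq_one_iff.1 (hdiff p0 hp0)
  have hper : ∀ p ∈ C, Λ (p.1 + 2 * Real.pi * Complex.I, p.2) - Λ p = n * (2 * Real.pi * Complex.I) := by
    intro p hp
    rw [← hn]
    exact const_of_exp hC.isPreconnected
      (f := fun p => Λ (p.1 + 2 * Real.pi * Complex.I, p.2) - Λ p)
      ((hΛ.comp (by fun_prop) hsh).sub hΛ) hdiff hp hp0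
  -- the function Λ - n w only depends on exp w
  have hnat : ∀ (N : ℕ) (w : ℂ) (v : E), (w, v) ∈ C →
      Λ (w + N * (2 * Real.pi * Complex.I), v) - n * (w + N * (2 * Real.pi * Complex.I))
        = Λ (w, v) - n * w := by
    intro N
    induction N with
    | zero => intro w v _; simp
    | succ N ih =>
      intro w v hw
      have h2 := ih _ _ (hsh _ hw)
      have h3 := hper _ hw
      simp only at h2 h3
      push_cast
      rw [show w + ((N:ℂ) + 1) * (2 * Real.pi * Complex.I) = w + 2 * Real.pi * Complex.I +
        N * (2 * Real.pi * Complex.I) by ring]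
      rw [h2]
      linear_combination h3
  have hwd : ∀ (w w' : ℂ) (v : E), (w, v) ∈ C → (w', v) ∈ C → Complex.exp w = Complex.exp w' →
      Λ (w, v) - n * w = Λ (w', v) - n * w' := by
    intro w w' v hw hw' hE
    obtain ⟨j, hj⟩ := Complex.exp_eq_exp_iff_exists_int.1 hE
    rcases le_total 0 j with h | h
    · lift j to ℕ using h
      rw [hj]
      simpa using hnat j w' v hw'
    · obtain ⟨j', rfl⟩ : ∃ j' : ℕ, j = -j' := ⟨(-j).toNat, by simp [h]⟩
      have : w' = w + j' * (2 * Real.pi * Complex.I) := by rw [hj]; push_cast; ring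
      rw [this]
      exact (hnat j' w v hw).symm
  refine ⟨n, Metric.ball q δ ∩ {v | ‖m k v‖ < δ}, ?_,
    fun v => Λ (Complex.log (m k v), v) - n * Complex.log (m k v), ?_, ?_⟩
  · refine inter_mem (Metric.ball_mem_nhds _ hδ) ((isOpen_lt (by fun_prop) continuous_const).mem_nhds ?_)
    simpa [hq.1] using hδ
  · have hre : ∀ v ∈ Acompl m, ‖m k v‖ < δ → ∀ w, Complex.exp w = m k v → w.re < Real.log δ := by
      intro v hv hlt w hw
      rw [Real.lt_log_iff_exp_lt hδ, ← Complex.norm_exp, hw]; exact hlt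
    rintro v0 ⟨⟨hv1, hv2⟩, hv3⟩
    have hz0 := hv3 k
    let w : E → ℂ := fun v => Complex.log (m k v / m k v0) + Complex.log (m k v0)
    have hwc : ContinuousAt w v0 := by
      refine ContinuousAt.add (ContinuousAt.clog (by fun_prop) ?_) continuousAt_const
      rw [div_self hz0]; exact Complex.one_mem_slitPlane
    have hwe : ∀ v ∈ Acompl m, Complex.exp (w v) = m k v := by
      intro v hv
      rw [Complex.exp_add, Complex.exp_log (div_ne_zero (hv k) hz0), Complex.exp_log hz0,
        div_mul_cancel₀ _ hz0]
    have hop : IsOpen C := by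
      refine IsOpen.prod ?_ Metric.isOpen_ball
      exact isOpen_lt Complex.continuous_re continuous_const
    have hmem : (w v0, v0) ∈ C := ⟨hre v0 hv3 hv2 _ (hwe v0 hv3), hv1⟩
    have hLc : ContinuousAt (fun v => Λ (w v, v) - n * w v) v0 := by
      have h2 : ContinuousAt Λ (w v0, v0) := hΛ.continuousAt (hop.mem_nhds hmem)
      have h3 : ContinuousAt (fun v => (w v, v)) v0 := hwc.prodMk continuousAt_id
      exact (ContinuousAt.comp (f := fun v => (w v, v)) h2 h3).sub (continuousAt_const.mul hwc)
    refine hLc.continuousWithinAt.congr ?_ ?_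
    · rintro v ⟨⟨h1, h2⟩, h3⟩
      exact hwd _ _ v ⟨hre v h3 h2 _ (Complex.exp_log (h3 k)), h1⟩ ⟨hre v h3 h2 _ (hwe v h3), h1⟩
        (by rw [Complex.exp_log (h3 k), hwe v h3])
    · exact hwd _ _ v0 ⟨hre v0 hv3 hv2 _ (Complex.exp_log hz0), hv1⟩ hmem
        (by rw [Complex.exp_log hz0, hwe v0 hv3])
  · rintro v ⟨⟨h1, h2⟩, h3⟩
    have hre : (Complex.log (m k v)).re < Real.log δ := by
      rw [Real.lt_log_iff_exp_lt hδ, ← Complex.norm_exp, Complex.exp_log (h3 k)]; exact h2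
    rw [Complex.exp_sub, hΛe (Complex.log (m k v), v) ⟨hre, h1⟩, Complex.exp_int_mul, Complex.exp_log (h3 k)]
    simp [div_eq_mul_inv]

theorem winding_unique {m : ι → E →L[ℂ] ℂ} {k : ι} (hk : m k ≠ 0) {q : E} (hq : q ∈ Gen m k)
    {n : ℤ} (h : LL (Acompl m) (fun v => (m k v) ^ n) q) : n = 0 := by
  obtain ⟨N, hN, g, hg, hge⟩ := h
  obtain ⟨e, he⟩ := exists_one hk
  have hcont : Continuous (fun z : ℂ => q + z • e) := by fun_prop
  have h1 : (fun z : ℂ => q + z • e) ⁻¹' (N ∩ {v | ∀ a, a ≠ k → m a v ≠ 0}) ∈ 𝓝 (0:ℂ) := by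
    apply hcont.continuousAt
    simpa using ⟨hN, others_nhds hq⟩
  obtain ⟨δ, hδ, hball⟩ := Metric.mem_nhds_iff.1 h1
  let c : ℝ → E := fun t => q + (((δ / 2 : ℝ) : ℂ) * Complex.exp (t * Complex.I)) • e
  have hc : ∀ t, c t ∈ N ∩ Acompl m := by
    intro t
    have : ((δ / 2 : ℝ) : ℂ) * Complex.exp (t * Complex.I) ∈ Metric.ball (0:ℂ) δ := by
      rw [mem_ball_zero_iff, norm_mul, Complex.norm_exp_ofReal_mul_I, mul_one, Complex.norm_real,
        Real.norm_eq_abs, abs_of_pos (by linarith)]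
      linarith
    have h2 := hball this
    refine ⟨h2.1, fun a => ?_⟩
    by_cases hak : a = k
    · subst hak
      simp [c, he, hq.1, hδ.ne']
    · exact h2.2 a hak
  have hck : ∀ t, m k (c t) = ((δ / 2 : ℝ) : ℂ) * Complex.exp (t * Complex.I) := by
    intro t; simp [c, he, hq.1]
  have hcc : Continuous c := by fun_prop
  have := const_of_exp isPreconnected_univ (f := fun t : ℝ => g (c t) - n * (t * Complex.I))
    (c := ((δ / 2 : ℝ) : ℂ) ^ n)
    ((hg.comp hcc.continuousOn (fun t _ => hc t)).sub (by fun_prop))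
    (by
      intro t _
      rw [Complex.exp_sub, hge _ (hc t), Complex.exp_int_mul]
      simp only [hck, mul_zpow]
      field_simp) (mem_univ 0) (mem_univ (2 * Real.pi))
  have hc0 : c 0 = c (2 * Real.pi) := by simp [c]
  simp only [hc0] at this
  have h3 : (n:ℂ) * (2 * Real.pi * Complex.I) = 0 := by push_cast at this; linear_combination this
  simpa [Complex.two_pi_I_ne_zero, Real.pi_ne_zero] using h3

theorem preconn_Gen (m : ι → E →L[ℂ] ℂ) (k : ι) : IsPreconnected (Gen m k) := by
  let K := LinearMap.ker (m k : E →ₗ[ℂ] ℂ)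
  have := preconn_Acompl (E := K) (fun a : {a // a ≠ k} => (m a.1).comp K.subtypeL)
  have h2 : Gen m k = Subtype.val ''
      (Acompl (E := K) (fun a : {a // a ≠ k} => (m a.1).comp K.subtypeL)) := by
    ext v
    simp only [Gen, Acompl, mem_ofPred_eq, mem_image]
    constructor
    · rintro ⟨h1, h2⟩
      exact ⟨⟨v, h1⟩, fun a => h2 a.1 a.2, rfl⟩
    · rintro ⟨w, hw, rfl⟩
      exact ⟨w.2, fun a ha => hw ⟨a, ha⟩⟩
  rw [h2]
  exact this.image _ continuous_subtype_val.continuousOn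

theorem exists_winding_all {m : ι → E →L[ℂ] ℂ} {k : ι} (hk : m k ≠ 0)
    {F : E → ℂ} (hF : ContinuousOn F (Acompl m)) (h0 : ∀ v ∈ Acompl m, F v ≠ 0) :
    ∃ n : ℤ, ∀ q ∈ Gen m k, LL (Acompl m) (fun v => F v * (m k v) ^ (-n)) q := by
  rcases (Gen m k).eq_empty_or_nonempty with h | ⟨q0, hq0⟩
  · exact ⟨0, by simp [h]⟩
  choose! n hn using fun q (hq : q ∈ Gen m k) => exists_winding hk hq hF h0
  refine ⟨n q0, fun q hq => ?_⟩
  have huniq : ∀ q ∈ Gen m k, ∀ n₁ n₂ : ℤ, LL (Acompl m) (fun v => F v * (m k v) ^ (-n₁)) q →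
      LL (Acompl m) (fun v => F v * (m k v) ^ (-n₂)) q → n₁ = n₂ := by
    intro q hq n₁ n₂ h1 h2
    have h3 := (h2.mul h1.inv).congr (G' := fun v => (m k v) ^ (n₁ - n₂)) (by
      intro v hv
      have := h0 v hv
      have := hv k
      rw [zpow_sub₀ this, zpow_neg, zpow_neg]
      field_simp)
    have := winding_unique hk hq h3
    omega
  have : n q = n q0 := by
    refine (preconn_Gen m k).constant (f := n) ?_ hq hq0
    intro p hp
    have h1 : ∀ᶠ x in 𝓝[Gen m k] p, n x = n p := by
      filter_upwards [nhdsWithin_le_nhds (hn p hp).eventually, self_mem_nhdsWithin] with x hx hxG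
      exact huniq x hxG _ _ (hn x hxG) hx
    exact (continuousWithinAt_const (b := n p)).congr_of_eventuallyEq h1 rfl
  rw [← this]
  exact hn q hq
end

section
variable {E : Type*} [NormedAddCommGroup E] [NormedSpace ℂ E] {ι : Type*} [Finite ι]

theorem main_log [BaireSpace E] {m : ι → E →L[ℂ] ℂ} (hm : ∀ a, m a ≠ 0)
    (hind : ∀ a b, a ≠ b → ∃ v, m a v = 0 ∧ m b v ≠ 0) {G : E → ℂ}
    (hG : ContinuousOn G (Acompl m)) (h0 : ∀ v ∈ Acompl m, G v ≠ 0)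
    (hLL : ∀ k, ∀ q ∈ Gen m k, LL (Acompl m) G q) :
    ∃ g : E → ℂ, ContinuousOn g (Acompl m) ∧ ∀ v ∈ Acompl m, Complex.exp (g v) = G v := by
  let := NormedSpace.complexToReal (E := E)
  obtain ⟨p, hp⟩ := (dense_Acompl hm).nonempty
  let m' : ι ⊕ {x : ι × ι // x.1 ≠ x.2} → E →L[ℂ] ℂ :=
    Sum.elim m (fun x => (m x.1.1 p) • m x.1.2 - (m x.1.2 p) • m x.1.1)
  have hm' : ∀ a, m' a ≠ 0 := by
    rintro (a | ⟨⟨a, b⟩, hab⟩)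
    · exact hm a
    · obtain ⟨v, hv1, hv2⟩ := hind a b hab
      intro h
      have := congrArg (fun f => f v) h
      simp [m', hv1, hv2] at this
      exact hp a this
  have hsub : Acompl m' ⊆ Acompl m := fun v hv a => hv (Sum.inl a)
  have hd := dense_Acompl hm'
  -- logs along lines
  have hline : ∀ q ∈ Acompl m', ∃ g : ℂ → ℂ,
      ContinuousOn g {t | p + t • (q - p) ∉ Acompl m}ᶜ ∧ g 0 = Complex.log (G p) ∧
      ∀ t, p + t • (q - p) ∈ Acompl m → Complex.exp (g t) = G (p + t • (q - p)) := by
    intro q hq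
    have hcont : Continuous (fun t : ℂ => p + t • (q - p)) := by fun_prop
    obtain ⟨g, hg, hge⟩ := planar_log (slice_finite m hp (q - p))
      (G := fun t => G (p + t • (q - p)))
      (hG.comp hcont.continuousOn (fun t ht => by simpa using ht))
      (fun t ht => h0 _ (by simpa using ht))
      (by
        intro s hs
        simp only [Acompl, mem_ofPred_eq, not_forall, not_not] at hs
        obtain ⟨k, hk⟩ := hs
        refine LL.comp hcont (hLL k _ ⟨hk, fun a hak hka => ?_⟩) (fun t ht => by simpa using ht)
        have hne := hq (Sum.inr ⟨(k, a), hak.symm⟩)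
        simp only [m', Sum.elim_inr, _root_.sub_apply, _root_.smul_apply,
          smul_eq_mul] at hne
        simp only [map_add, map_smul, map_sub, smul_eq_mul] at hk hka
        by_cases hs0 : s = 0
        · subst hs0; exact hp k (by simpa using hk)
        · apply hne
          have : s * (m k p * m a q - m a p * m k q) = 0 := by
            linear_combination m k p * hka - m a p * hk
          exact (mul_eq_zero.1 this).resolve_left hs0)
    refine ⟨fun t => g t + (Complex.log (G p) - g 0), hg.add continuousOn_const, by simp, ?_⟩
    intro t ht
    have h1 := hge t (by simpa using ht)
    have h2 := hge 0 (by simpa using hp)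
    simp only [zero_smul, add_zero] at h2
    rw [Complex.exp_add, Complex.exp_sub, h1, h2, Complex.exp_log (h0 p hp), div_self (h0 p hp),
      mul_one]
  choose! L hLc hL0 hLe using hline
  have hg : ContinuousOn (fun q => L q 1) (Acompl m') := by
    intro q0 hq0
    obtain ⟨σ, hσ, hs0, hs1, hσm⟩ := preconn_diff_finite (T := univ) isOpen_univ convex_univ
      (slice_finite m hp (q0 - p)) ⟨trivial, by simpa using hp⟩
      ⟨trivial, by simpa using hsub hq0⟩
    have hev : ∀ᶠ q in 𝓝 q0, ∀ s ∈ Icc (0:ℝ) 1, p + σ s • (q - p) ∈ Acompl m := by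
      refine isCompact_Icc.eventually_forall_of_forall_eventually ?_
      intro s hs
      have hc : Continuous (fun z : E × ℝ => p + σ z.2 • (z.1 - p)) := by fun_prop
      apply hc.continuousAt.eventually_mem
      apply (isOpen_Acompl m).mem_nhds
      simpa using (hσm s hs).2
    obtain ⟨r, hr, hrb⟩ := Metric.eventually_nhds_iff_ball.1 hev
    obtain ⟨Λ, hΛ, hΛe⟩ := exists_log_of_convex (C := Metric.ball q0 r ×ˢ Icc (0:ℝ) 1)
      (G := fun z => G (p + σ z.2 • (z.1 - p)))
      ((convex_ball q0 r).prod (convex_Icc 0 1)) ⟨(q0, 0), by simpa using hr, by simp⟩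
      (hG.comp (by fun_prop) (fun z hz => hrb z.1 hz.1 z.2 hz.2))
      (fun z hz => h0 _ (hrb z.1 hz.1 z.2 hz.2))
    have h00 : (0:ℝ) ∈ Icc (0:ℝ) 1 := by simp
    have h11 : (1:ℝ) ∈ Icc (0:ℝ) 1 := by simp
    have hbc : ContinuousOn (fun q => Λ (q, 0)) (Metric.ball q0 r) :=
      hΛ.comp (by fun_prop) (fun q hq => ⟨hq, h00⟩)
    have hbc1 : ContinuousOn (fun q => Λ (q, 1)) (Metric.ball q0 r) :=
      hΛ.comp (by fun_prop) (fun q hq => ⟨hq, h11⟩)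
    have hq0b := Metric.mem_ball_self (x := q0) hr
    have hc0 : ∀ q ∈ Metric.ball q0 r, Λ (q, 0) = Λ (q0, 0) := by
      intro q hq
      refine const_of_exp (convex_ball q0 r).isPreconnected (f := fun q => Λ (q, 0)) (c := G p)
        hbc ?_ hq hq0b
      intro x hx
      rw [hΛe (x, 0) ⟨hx, h00⟩]
      simp [hs0]
    have heq : ∀ q ∈ Metric.ball q0 r, q ∈ Acompl m' →
        L q 1 = Λ (q, 1) + (Complex.log (G p) - Λ (q0, 0)) := by
      intro q hq hqm
      have hmap : MapsTo σ (Icc 0 1) {t | p + t • (q - p) ∉ Acompl m}ᶜ := by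
        intro s hs
        simpa using hrb q hq s hs
      have := const_of_exp isPreconnected_Icc (f := fun s : ℝ => L q (σ s) - Λ (q, s)) (c := 1)
        (((hLc q hqm).comp hσ.continuousOn hmap).sub
          (hΛ.comp (by fun_prop) (fun s hs => ⟨hq, hs⟩)))
        (by
          intro s hs
          have h3 := hrb q hq s hs
          rw [Complex.exp_sub, hLe q hqm _ h3, hΛe (q, s) ⟨hq, hs⟩]
          exact div_self (h0 _ h3)) h00 h11
      simp only [hs0, hs1, hL0 q hqm, hc0 q hq] at this
      linear_combination -this
    have h4 : ContinuousAt (fun q => Λ (q, 1) + (Complex.log (G p) - Λ (q0, 0))) q0 :=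
      (hbc1.continuousAt (Metric.ball_mem_nhds q0 hr)).add continuousAt_const
    refine h4.continuousWithinAt.congr_of_eventuallyEq ?_ (heq q0 hq0b hq0)
    filter_upwards [nhdsWithin_le_nhds (Metric.ball_mem_nhds q0 hr), self_mem_nhdsWithin]
      with q hq hqm
    exact heq q hq hqm
  have := extend_log hd (isOpen_Acompl m) hG h0 hg (by
    intro q hq _
    have h1 := hLe q hq 1 (by simpa using hsub hq)
    simpa using h1)
  exact ⟨_, this.1, fun v hv => (this.2 v hv).2⟩
end

section
variable {E : Type*} [NormedAddCommGroup E] [NormedSpace ℂ E] {ι : Type*} [Finite ι]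

structure RelMap (m m' : ι → E →L[ℂ] ℂ) (T : E → E) : Prop where
  zero_iff : ∀ k v, v ≠ 0 → (m' k (T v) = 0 ↔ m k v = 0)
  cont : ∀ l, ContinuousOn (fun v => (m' l (T v))⁻¹ • T v) {v | m l v ≠ 0}
  homog : ∀ (c : ℂ) v, c ≠ 0 → v ≠ 0 → T (c • v) = T v

theorem ne_zero_of_form {f : E →L[ℂ] ℂ} {v : E} (h : f v ≠ 0) : v ≠ 0 := by
  rintro rfl; simp at h

theorem RelMap.ne {m m' : ι → E →L[ℂ] ℂ} {T : E → E} (hT : RelMap m m' T)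
    {k : ι} {v : E} (h : m k v ≠ 0) : m' k (T v) ≠ 0 := fun h' =>
  h ((hT.zero_iff k v (ne_zero_of_form h)).1 h')

theorem RelMap.ratio_cont {m m' : ι → E →L[ℂ] ℂ} {T : E → E} (hT : RelMap m m' T) (k l : ι) :
    ContinuousOn (fun v => m' k (T v) / m' l (T v)) {v | m l v ≠ 0} := by
  have := (m' k).continuous.comp_continuousOn (hT.cont l)
  refine this.congr fun v _ => ?_
  simp [div_eq_inv_mul]


theorem open_form (f : E →L[ℂ] ℂ) : IsOpen {v | f v ≠ 0} := isOpen_ne_fun f.continuous continuous_const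

theorem LL_form {U : Set E} {f : E →L[ℂ] ℂ} {q : E} (h : f q ≠ 0) (n : ℤ) :
    LL U (fun v => (f v) ^ n) q := by
  refine LL.of_cont (N := {v | f v ≠ 0}) ((open_form f).mem_nhds h) ?_ (zpow_ne_zero _ h)
  exact f.continuous.continuousOn.zpow₀ n (fun v hv => Or.inl hv)

theorem RelMap.degree [BaireSpace E] [Nontrivial ι] {m m' : ι → E →L[ℂ] ℂ} {T : E → E}
    (hT : RelMap m m' T) (hm : ∀ a, m a ≠ 0)
    (hind : ∀ a b, a ≠ b → ∃ v, m a v = 0 ∧ m b v ≠ 0) :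
    ∃ d : ℤ, ∀ k l, ∃ g : E → ℂ, ContinuousOn g (Acompl m) ∧
      ∀ v ∈ Acompl m, Complex.exp (g v) * (m k v / m l v) ^ d = m' k (T v) / m' l (T v) := by
  have hFU : ∀ k l, ContinuousOn (fun v => m' k (T v) / m' l (T v)) (Acompl m) := fun k l =>
    (hT.ratio_cont k l).mono fun v hv => hv l
  have hF0 : ∀ k l v, m k v ≠ 0 → m l v ≠ 0 → m' k (T v) / m' l (T v) ≠ 0 := fun k l v h1 h2 =>
    div_ne_zero (hT.ne h1) (hT.ne h2)
  have hFLL : ∀ k l q, m k q ≠ 0 → m l q ≠ 0 →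
      LL (Acompl m) (fun v => m' k (T v) / m' l (T v)) q := fun k l q h1 h2 =>
    LL.of_cont ((open_form (m l)).mem_nhds h2) (hT.ratio_cont k l) (hF0 k l q h1 h2)
  have hD : ∀ k, ∃ n : ℤ, ∀ l, l ≠ k → ∀ q ∈ Gen m k,
      LL (Acompl m) (fun v => m' k (T v) / m' l (T v) * (m k v) ^ (-n)) q := by
    intro k
    obtain ⟨l0, hl0⟩ := exists_ne k
    obtain ⟨n, hn⟩ := exists_winding_all (hm k) (hFU k l0) (fun v hv => hF0 k l0 v (hv k) (hv l0))
    refine ⟨n, fun l hl q hq => ?_⟩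
    refine ((hn q hq).mul (hFLL l0 l q (hq.2 l0 hl0) (hq.2 l hl))).congr ?_
    intro v hv
    have h1 := hT.ne (hv l0)
    have h2 := hT.ne (hv l)
    field_simp
  choose d hd using hD
  have hGlog : ∀ k l, k ≠ l → ∃ g : E → ℂ, ContinuousOn g (Acompl m) ∧ ∀ v ∈ Acompl m,
      Complex.exp (g v) = m' k (T v) / m' l (T v) * (m k v) ^ (-d k) * (m l v) ^ (d l) := by
    intro k l hkl
    refine main_log hm hind ?_ ?_ ?_
    · exact ((hFU k l).mul ((m k).continuous.continuousOn.zpow₀ _ fun v hv => Or.inl (hv k))).mul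
        ((m l).continuous.continuousOn.zpow₀ _ fun v hv => Or.inl (hv l))
    · intro v hv
      exact mul_ne_zero (mul_ne_zero (hF0 k l v (hv k) (hv l)) (zpow_ne_zero _ (hv k)))
        (zpow_ne_zero _ (hv l))
    · intro a q hq
      by_cases hak : a = k
      · subst hak
        exact (hd a l hkl.symm q hq).mul (LL_form (hq.2 l hkl.symm) _)
      by_cases hal : a = l
      · subst hal
        refine ((hd a k hkl q hq).inv.mul (LL_form (hq.2 k hkl) (-d k))).congr ?_
        intro v hv
        have h1 := hT.ne (hv k)
        have h2 := hT.ne (hv a)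
        have h3 := hv a
        have h4 := hv k
        simp only [zpow_neg]
        field_simp
      · exact ((hFLL k l q (hq.2 k (Ne.symm hak)) (hq.2 l (Ne.symm hal))).mul
          (LL_form (hq.2 k (Ne.symm hak)) _)).mul (LL_form (hq.2 l (Ne.symm hal)) _)
  have hdeq : ∀ k l, d k = d l := by
    intro k l
    by_cases hkl : k = l
    · rw [hkl]
    obtain ⟨g, hg, hge⟩ := hGlog k l hkl
    obtain ⟨v, hv⟩ := (dense_Acompl hm).nonempty
    let c : ℝ → E := fun t => Complex.exp (t * Complex.I) • v
    have hcc : Continuous c := by fun_prop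
    have hc : ∀ t, c t ∈ Acompl m := fun t a => by
      simpa [c] using hv a
    have := const_of_exp isPreconnected_univ
      (f := fun t : ℝ => g (c t) - ((d l - d k : ℤ) : ℂ) * (t * Complex.I))
      (c := m' k (T v) / m' l (T v) * (m k v) ^ (-d k) * (m l v) ^ (d l))
      ((hg.comp hcc.continuousOn (fun t _ => hc t)).sub (by fun_prop))
      (by
        intro t _
        have hT' : T (c t) = T v := hT.homog _ _ (Complex.exp_ne_zero _) (ne_zero_of_form (hv k))
        have h1 : ∀ a, m a (c t) = Complex.exp (t * Complex.I) * m a v := fun a => by simp [c]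
        rw [Complex.exp_sub, hge _ (hc t), Complex.exp_int_mul, hT', h1, h1, mul_zpow, mul_zpow,
          zpow_sub₀ (Complex.exp_ne_zero _), zpow_neg, zpow_neg]
        have h2 := Complex.exp_ne_zero (t * Complex.I)
        have h3 := hv k
        have h4 := hT.ne (hv l)
        field_simp) (mem_univ 0) (mem_univ (2 * Real.pi))
    have hc0 : c 0 = c (2 * Real.pi) := by simp [c]
    simp only [hc0] at this
    have h3 : ((d l - d k : ℤ) : ℂ) * (2 * Real.pi * Complex.I) = 0 := by
      push_cast at this ⊢; linear_combination this
    rcases mul_eq_zero.1 h3 with h | h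
    · have := Int.cast_eq_zero.1 h
      omega
    · exact absurd h Complex.two_pi_I_ne_zero
  obtain ⟨k0⟩ : Nonempty ι := inferInstance
  refine ⟨d k0, fun k l => ?_⟩
  by_cases hkl : k = l
  · subst hkl
    refine ⟨fun _ => 0, continuousOn_const, fun v hv => ?_⟩
    rw [div_self (hv k), div_self (hT.ne (hv k))]; simp
  obtain ⟨g, hg, hge⟩ := hGlog k l hkl
  refine ⟨g, hg, fun v hv => ?_⟩
  rw [hge v hv, hdeq k k0, hdeq l k0, div_zpow, zpow_neg]
  have h1 := hv k
  have h2 := hv l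
  field_simp

theorem RelMap.degree_mul {m m' : ι → E →L[ℂ] ℂ} {T T' : E → E}
    (hT : RelMap m m' T) (hT' : RelMap m' m T')
    (hTT : ∀ v, v ≠ 0 → ∃ c : ℂ, c ≠ 0 ∧ T' (T v) = c • v) {k l : ι} (hkl : l ≠ k)
    (hm : m k ≠ 0) {q : E} (hq : q ∈ Gen m k) {d d' : ℤ} {g g' : E → ℂ}
    (hg : ContinuousOn g (Acompl m)) (hg' : ContinuousOn g' (Acompl m'))
    (h : ∀ v ∈ Acompl m, Complex.exp (g v) * (m k v / m l v) ^ d = m' k (T v) / m' l (T v))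
    (h' : ∀ v ∈ Acompl m', Complex.exp (g' v) * (m' k v / m' l v) ^ d' = m k (T' v) / m l (T' v)) :
    d * d' = 1 := by
  have hhom : ∀ w ∈ Acompl m', ∀ c : ℂ, c ≠ 0 → g' (c • w) = g' w := by
    intro w hw c hc
    have hmem : ∀ c : ℂ, c ≠ 0 → c • w ∈ Acompl m' := fun c hc a => by
      simpa [hc] using hw a
    have h1 := (isConnected_compl_singleton_of_one_lt_rank (E := ℂ) (by simp [Complex.rank_real_complex])
      (0:ℂ)).isPreconnected
    have := const_of_exp h1 (f := fun c => g' (c • w)) (c := Complex.exp (g' w))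
      (hg'.comp (by fun_prop) (fun c hc => hmem c hc))
      (by
        intro c hc
        have hc : c ≠ 0 := hc
        have e1 := h' _ (hmem c hc)
        have e2 := h' w hw
        rw [hT'.homog c w hc (ne_zero_of_form (hw k)), ← e2] at e1
        simp only [map_smul, smul_eq_mul, mul_div_mul_left _ _ hc] at e1
        exact mul_right_cancel₀ (zpow_ne_zero _ (div_ne_zero (hw k) (hw l))) e1)
      (show c ∈ ({0}:Set ℂ)ᶜ from hc) (show (1:ℂ) ∈ ({0}:Set ℂ)ᶜ by simp)
    simpa using this
  have hTm : ∀ v ∈ Acompl m, T v ∈ Acompl m' := fun v hv a => hT.ne (hv a)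
  have hcont : ContinuousOn (fun v => g' (T v)) (Acompl m) := by
    have h1 : ContinuousOn (fun v => g' ((m' l (T v))⁻¹ • T v)) (Acompl m) := by
      refine hg'.comp ((hT.cont l).mono fun v hv => hv l) ?_
      intro v hv a
      have := hTm v hv l
      simpa [this] using hTm v hv a
    refine h1.congr fun v hv => ?_
    exact (hhom _ (hTm v hv) _ (inv_ne_zero (hTm v hv l))).symm
  have hLL : LL (Acompl m) (fun v => (m k v / m l v) ^ (1 - d * d')) q := by
    refine LL.of_log (g := fun v => g' (T v) + d' * g v) (hcont.add (continuousOn_const.mul hg)) ?_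
    intro v hv
    obtain ⟨c, hc, hcv⟩ := hTT v (ne_zero_of_form (hv k))
    have e1 := h' _ (hTm v hv)
    rw [hcv, ← h v hv] at e1
    simp only [map_smul, smul_eq_mul, mul_div_mul_left _ _ hc] at e1
    have h3 : m k v / m l v ≠ 0 := div_ne_zero (hv k) (hv l)
    rw [Complex.exp_add, Complex.exp_int_mul, zpow_sub₀ h3, zpow_one,
      eq_div_iff (zpow_ne_zero _ h3), zpow_mul, mul_assoc, ← mul_zpow, e1]
  have hLL2 := (hLL.mul (LL_form (hq.2 l hkl) (1 - d * d'))).congr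
    (G' := fun v => (m k v) ^ (1 - d * d')) (by
      intro v hv
      rw [← mul_zpow, div_mul_cancel₀ _ (hv l)])
  have := winding_unique hm hq hLL2
  omega
end

section
variable {E : Type*} [NormedAddCommGroup E] [NormedSpace ℂ E] {ι : Type*} [Finite ι]

theorem preconn_ker (f : E →L[ℂ] ℂ) (m : ι → E →L[ℂ] ℂ) :
    IsPreconnected {v | f v = 0 ∧ ∀ a, m a v ≠ 0} := by
  let K := LinearMap.ker (f : E →ₗ[ℂ] ℂ)
  have := preconn_Acompl (E := K) (fun a => (m a).comp K.subtypeL)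
  have h2 : {v | f v = 0 ∧ ∀ a, m a v ≠ 0} = Subtype.val ''
      (Acompl (E := K) (fun a => (m a).comp K.subtypeL)) := by
    ext v
    simp only [Acompl, mem_ofPred_eq, mem_image]
    constructor
    · rintro ⟨h1, h2⟩
      exact ⟨⟨v, h1⟩, h2, rfl⟩
    · rintro ⟨w, hw, rfl⟩
      exact ⟨w.2, hw⟩
  rw [h2]
  exact this.image _ continuous_subtype_val.continuousOn

theorem RelMap.exists_X [BaireSpace E] {m m' : ι → E →L[ℂ] ℂ} {T : E → E}
    (hT : RelMap m m' T) (hm : ∀ a, m a ≠ 0) {d : ℤ} (k0 : ι) {g : ι → E → ℂ}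
    (hg : ∀ l, ContinuousOn (g l) (Acompl m))
    (hge : ∀ l, ∀ v ∈ Acompl m,
      Complex.exp (g l v) * (m l v / m k0 v) ^ d = m' l (T v) / m' k0 (T v)) :
    ∃ X : E → ι → ℂ, ∀ l l',
      ContinuousOn (fun v => X v l - X v l') {v | m l v ≠ 0 ∧ m l' v ≠ 0} ∧
      ∀ v, m l v ≠ 0 → m l' v ≠ 0 →
        Complex.exp (X v l - X v l') * (m l v / m l' v) ^ d = m' l (T v) / m' l' (T v) := by
  have hd := dense_Acompl hm
  let e : ι → ι → E → ℂ := fun l l' => extendFrom (Acompl m) (fun v => g l v - g l' v)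
  have key : ∀ l l', ContinuousOn (e l l') {v | m l v ≠ 0 ∧ m l' v ≠ 0} ∧
      ∀ v ∈ {v | m l v ≠ 0 ∧ m l' v ≠ 0},
        Tendsto (fun v => g l v - g l' v) (𝓝[Acompl m] v) (𝓝 (e l l' v)) ∧
        Complex.exp (e l l' v) = m' l (T v) / m' l' (T v) * (m l' v / m l v) ^ d := by
    intro l l'
    refine extend_log hd ((open_form (m l)).inter (open_form (m l'))) ?_ ?_
      ((hg l).sub (hg l')) ?_
    · refine ((hT.ratio_cont l l').mono fun v hv => hv.2).mul ?_
      refine ContinuousOn.zpow₀ ?_ d fun v hv => Or.inl (div_ne_zero hv.2 hv.1)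
      exact (m l').continuous.continuousOn.div (m l).continuous.continuousOn fun v hv => hv.1
    · intro v hv
      exact mul_ne_zero (div_ne_zero (hT.ne hv.1) (hT.ne hv.2))
        (zpow_ne_zero _ (div_ne_zero hv.2 hv.1))
    · intro v hv _
      have h1 := hge l v hv
      have h2 := hge l' v hv
      have a1 := hv l
      have a2 := hv l'
      have a3 := hv k0
      have b1 := hT.ne a1
      have b2 := hT.ne a2
      have b3 := hT.ne a3
      rw [← eq_div_iff (zpow_ne_zero _ (div_ne_zero a1 a3))] at h1
      rw [← eq_div_iff (zpow_ne_zero _ (div_ne_zero a2 a3))] at h2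
      rw [Complex.exp_sub, h1, h2]
      simp only [div_zpow]
      field_simp
  have : Nonempty ι := ⟨k0⟩
  choose! c hc using fun (v : E) (h : ∃ l, m l v ≠ 0) => h
  refine ⟨fun v l => e l (c v) v, fun l l' => ?_⟩
  have hX : ∀ v, m l v ≠ 0 → m l' v ≠ 0 → e l (c v) v - e l' (c v) v = e l l' v := by
    intro v h1 h2
    have h3 := hc v ⟨l, h1⟩
    have : (𝓝[Acompl m] v).NeBot := mem_closure_iff_nhdsWithin_neBot.1 (hd v)
    have t1 := ((key l (c v)).2 v ⟨h1, h3⟩).1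
    have t2 := ((key l' (c v)).2 v ⟨h2, h3⟩).1
    have t3 := ((key l l').2 v ⟨h1, h2⟩).1
    refine tendsto_nhds_unique (t1.sub t2) (t3.congr fun w => ?_)
    ring
  refine ⟨(key l l').1.congr fun v hv => hX v hv.1 hv.2, fun v h1 h2 => ?_⟩
  rw [hX v h1 h2, ((key l l').2 v ⟨h1, h2⟩).2, mul_assoc, ← mul_zpow]
  rw [show m l' v / m l v * (m l v / m l' v) = 1 by field_simp]
  simp

theorem RelMap.X_const {m m' : ι → E →L[ℂ] ℂ} {T : E → E}
    (hT : RelMap m m' T) {d : ℤ} {X : E → ι → ℂ}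
    (hX : ∀ l l',
      ContinuousOn (fun v => X v l - X v l') {v | m l v ≠ 0 ∧ m l' v ≠ 0} ∧
      ∀ v, m l v ≠ 0 → m l' v ≠ 0 →
        Complex.exp (X v l - X v l') * (m l v / m l' v) ^ d = m' l (T v) / m' l' (T v))
    {k l l' : ι} (hcm : ∀ v w, m k v = 0 → m k w = 0 → m l v * m l' w = m l w * m l' v)
    (hcm' : ∀ v w, m' k v = 0 → m' k w = 0 → m' l v * m' l' w = m' l w * m' l' v)
    {v w : E} (hv : m k v = 0) (hvl : m l v ≠ 0) (hvl' : m l' v ≠ 0)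
    (hw : m k w = 0) (hwl : m l w ≠ 0) (hwl' : m l' w ≠ 0) :
    X v l - X v l' = X w l - X w l' := by
  have hS := preconn_ker (m k) (fun b : Bool => if b then m l else m l')
  have hS' : {v | m k v = 0 ∧ ∀ b : Bool, (if b then m l else m l') v ≠ 0} =
      {v | m k v = 0 ∧ m l v ≠ 0 ∧ m l' v ≠ 0} := by
    ext v; simp [and_comm]
  rw [hS'] at hS
  refine const_of_exp hS (f := fun v => X v l - X v l') (c := Complex.exp (X w l - X w l'))
    ((hX l l').1.mono fun v hv => hv.2) ?_ ⟨hv, hvl, hvl'⟩ ⟨hw, hwl, hwl'⟩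
  rintro u ⟨hu, hul, hul'⟩
  have h1 := (hX l l').2 u hul hul'
  have h2 := (hX l l').2 w hwl hwl'
  have h3 : m l u / m l' u = m l w / m l' w := by
    rw [div_eq_div_iff hul' hwl']; exact hcm u w hu hw
  have h4 : m' l (T u) / m' l' (T u) = m' l (T w) / m' l' (T w) := by
    rw [div_eq_div_iff (hT.ne hul') (hT.ne hwl')]
    exact hcm' _ _ ((hT.zero_iff k u (ne_zero_of_form hul)).2 hu)
      ((hT.zero_iff k w (ne_zero_of_form hwl)).2 hw)
  rw [h3, h4, ← h2] at h1
  exact mul_right_cancel₀ (zpow_ne_zero _ (div_ne_zero hwl hwl')) h1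
end

noncomputable def form (a b c : ℂ) : (Fin 3 → ℂ) →L[ℂ] ℂ :=
  a • ContinuousLinearMap.proj 0 + b • ContinuousLinearMap.proj 1 + c • ContinuousLinearMap.proj 2

theorem form_apply (a b c : ℂ) (v : Fin 3 → ℂ) : form a b c v = a * v 0 + b * v 1 + c * v 2 := by
  simp [form]

noncomputable def ml (α : ℂ) : Fin 10 → (Fin 3 → ℂ) →L[ℂ] ℂ :=
  ![form 0 0 1, form 1 0 0, form (α^2+α) (-(α+1)) 1, form 0 1 0, form 0 1 (-1), form 1 0 (-1),
    form α (-(α+1)) 1, form (α^2+α) (-(α^2+α+1)) 1, form α (-1) 1, form (α^3) 1 0]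

theorem Mline_eq (α : ℂ) (k : Fin 10) : Mline α k = {p | ml α k p.rep = 0} := by
  fin_cases k <;> ext p <;> simp [Mline, ml, projLine, form_apply]

theorem rep_mk_smul (v : Fin 3 → ℂ) (hv : v ≠ 0) :
    ∃ c : ℂ, c ≠ 0 ∧ (mk ℂ v hv).rep = c • v := by
  obtain ⟨a, ha⟩ := exists_smul_eq_mk_rep ℂ v hv
  exact ⟨a, a.ne_zero, ha.symm⟩

open Classical in
noncomputable def Tmap (h : CP2 ≃ₜ CP2) (v : Fin 3 → ℂ) : Fin 3 → ℂ :=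
  if hv : v ≠ 0 then (h (mk ℂ v hv)).rep else 0

theorem continuousOn_norm_rep (f : (Fin 3 → ℂ) →L[ℂ] ℂ) :
    IsOpen {p : CP2 | f p.rep ≠ 0} ∧
    ContinuousOn (fun p : CP2 => (f p.rep)⁻¹ • p.rep) {p : CP2 | f p.rep ≠ 0} := by
  let π : {v : Fin 3 → ℂ // v ≠ 0} → CP2 := fun v => mk ℂ v.1 v.2
  have hπ : IsQuotientMap π := isQuotientMap_quotient_mk'
  have hpre : π ⁻¹' {p : CP2 | f p.rep ≠ 0} = {v | f v.1 ≠ 0} := by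
    ext v
    obtain ⟨c, hc, hcv⟩ := rep_mk_smul v.1 v.2
    simp [π, hcv, hc]
  have ho : IsOpen {p : CP2 | f p.rep ≠ 0} := by
    rw [← hπ.isOpen_preimage, hpre]
    exact isOpen_ne_fun (by fun_prop) continuous_const
  refine ⟨ho, ?_⟩
  rw [hπ.continuousOn_isOpen_iff ho, hpre]
  have : ContinuousOn (fun v : {v : Fin 3 → ℂ // v ≠ 0} => (f v.1)⁻¹ • v.1) {v | f v.1 ≠ 0} := by
    refine ContinuousOn.smul (ContinuousOn.inv₀ (by fun_prop) fun v hv => hv) (by fun_prop)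
  refine this.congr fun v hv => ?_
  obtain ⟨c, hc, hcv⟩ := rep_mk_smul v.1 v.2
  simp only [Function.comp, π, hcv, map_smul, smul_eq_mul, smul_smul]
  congr 1
  field_simp

theorem relMap_Tmap {α β : ℂ} (h : CP2 ≃ₜ CP2) (hh : ∀ k, h '' Mline α k = Mline β k) :
    RelMap (ml α) (ml β) (Tmap h) := by
  have hz : ∀ k v, v ≠ 0 → (ml β k (Tmap h v) = 0 ↔ ml α k v = 0) := by
    intro k v hv
    have h1 : h (mk ℂ v hv) ∈ Mline β k ↔ mk ℂ v hv ∈ Mline α k := by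
      rw [← hh k]; exact h.injective.mem_set_image
    rw [Mline_eq, Mline_eq] at h1
    obtain ⟨c, hc, hcv⟩ := rep_mk_smul v hv
    simp only [mem_ofPred_eq, hcv, map_smul, smul_eq_mul, mul_eq_zero, hc, false_or] at h1
    simpa [Tmap, hv] using h1
  refine ⟨hz, ?_, ?_⟩
  · intro l
    obtain ⟨-, h2⟩ := continuousOn_norm_rep (ml β l)
    rw [continuousOn_iff_continuous_domRestrict]
    have hne : ∀ v : {v | ml α l v ≠ 0}, v.1 ≠ 0 := fun v => ne_zero_of_form v.2
    let F : {v | ml α l v ≠ 0} → CP2 := fun v => mk ℂ v.1 (hne v)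
    have hF : Continuous F := by
      have : Continuous (fun v : {v : Fin 3 → ℂ // v ≠ 0} => (mk ℂ v.1 v.2 : CP2)) :=
        continuous_quotient_mk'
      exact this.comp (f := fun v : {v | ml α l v ≠ 0} => (⟨v.1, hne v⟩ : {v : Fin 3 → ℂ // v ≠ 0}))
        (by fun_prop)
    have hT : ∀ v : {v | ml α l v ≠ 0}, Tmap h v.1 = (h (F v)).rep := fun v => by
      simp [Tmap, hne v, F]
    have h3 := h2.comp_continuous (h.continuous.comp hF) (fun v => by
      have := mt (hz l v.1 (hne v)).1 v.2
      rw [hT] at this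
      exact this)
    refine h3.congr fun v => ?_
    simp [hT]
  · intro c v hc hv
    have hcv : c • v ≠ 0 := smul_ne_zero hc hv
    have : mk ℂ (c • v) hcv = mk ℂ v hv := by
      rw [mk_eq_mk_iff']; exact ⟨c, rfl⟩
    simp [Tmap, hv, hc, this]

theorem Tmap_Tmap (h : CP2 ≃ₜ CP2) (v : Fin 3 → ℂ) (hv : v ≠ 0) :
    ∃ c : ℂ, c ≠ 0 ∧ Tmap h.symm (Tmap h v) = c • v := by
  have h1 : Tmap h v = (h (mk ℂ v hv)).rep := by simp [Tmap, hv]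
  have h2 : Tmap h.symm (Tmap h v) = (mk ℂ v hv).rep := by
    rw [h1]
    simp [Tmap, rep_nonzero]
  rw [h2]
  exact rep_mk_smul v hv

theorem conc_form {a b c a1 b1 c1 a2 b2 c2 : ℂ} (hne : a ≠ 0 ∨ b ≠ 0 ∨ c ≠ 0)
    (hd : a * (b1 * c2 - b2 * c1) - b * (a1 * c2 - a2 * c1) + c * (a1 * b2 - a2 * b1) = 0)
    (v w : Fin 3 → ℂ) (hv : form a b c v = 0) (hw : form a b c w = 0) :
    form a1 b1 c1 v * form a2 b2 c2 w = form a1 b1 c1 w * form a2 b2 c2 v := by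
  simp only [form_apply] at *
  generalize v 0 = v0 at *
  generalize v 1 = v1 at *
  generalize v 2 = v2 at *
  generalize w 0 = w0 at *
  generalize w 1 = w1 at *
  generalize w 2 = w2 at *
  rcases hne with h | h | h <;> apply mul_left_cancel₀ h <;> grind

/-- Coefficients of the lines. -/
noncomputable def cf (α : ℂ) : Fin 10 → ℂ × ℂ × ℂ :=
  ![(0, 0, 1), (1, 0, 0), (α^2+α, -(α+1), 1), (0, 1, 0), (0, 1, -1), (1, 0, -1),
    (α, -(α+1), 1), (α^2+α, -(α^2+α+1), 1), (α, -1, 1), (α^3, 1, 0)]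

theorem ml_cf (α : ℂ) (k : Fin 10) : ml α k = form (cf α k).1 (cf α k).2.1 (cf α k).2.2 := by
  fin_cases k <;> rfl

theorem cf_ne (α : ℂ) (k : Fin 10) :
    (cf α k).1 ≠ 0 ∨ (cf α k).2.1 ≠ 0 ∨ (cf α k).2.2 ≠ 0 := by
  fin_cases k <;> simp [cf]

/-- Concurrent triples of lines. -/
def triples : List (Fin 10 × Fin 10 × Fin 10) :=
  [(0, 1, 5), (0, 2, 8), (0, 3, 4), (0, 7, 9), (1, 2, 6), (1, 3, 9), (1, 4, 8), (2, 3, 7), (2, 5, 9), (3, 6, 8), (4, 5, 6), (4, 5, 7), (4, 6, 7), (5, 6, 7)]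

theorem dets {α : ℂ} (hα : α^4 + α^3 + α^2 + α + 1 = 0) (k l m : Fin 10)
    (h : (k, l, m) ∈ triples) :
    (cf α k).1 * ((cf α l).2.1 * (cf α m).2.2 - (cf α m).2.1 * (cf α l).2.2)
      - (cf α k).2.1 * ((cf α l).1 * (cf α m).2.2 - (cf α m).1 * (cf α l).2.2)
      + (cf α k).2.2 * ((cf α l).1 * (cf α m).2.1 - (cf α m).1 * (cf α l).2.1) = 0 := by
  simp only [triples, List.mem_cons, Prod.mk.injEq, List.not_mem_nil, or_false] at h
  casesm* _ ∨ _ <;> (obtain ⟨rfl, rfl, rfl⟩ := h; simp [cf]; try grind)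

theorem conc {α : ℂ} (hα : α^4 + α^3 + α^2 + α + 1 = 0) (k l m : Fin 10)
    (h : (k, l, m) ∈ triples ∨ (l, k, m) ∈ triples ∨ (l, m, k) ∈ triples) (v w : Fin 3 → ℂ)
    (hv : ml α k v = 0) (hw : ml α k w = 0) :
    ml α l v * ml α m w = ml α l w * ml α m v := by
  rw [ml_cf] at *
  rw [ml_cf α m]
  refine conc_form (cf_ne α k) ?_ v w hv hw
  rcases h with h | h | h <;> have := dets hα _ _ _ h
  · linear_combination this
  · linear_combination -this
  · linear_combination this

noncomputable def pt (α : ℂ) : Fin 12 → Fin 3 → ℂ :=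
  ![![0, 1, 0], ![1, α, 0], ![1, 0, 0], ![0, 0, 1], ![0, 1, 1], ![0, 1, α^2+α+1], ![1, -α^3, 1], ![1, 0, 1], ![1, 1, 1], ![1, 0, -(α^2+α)], ![1, α+1, α+1], ![1, 0, -α]]

def inc : Fin 12 → List (Fin 10) :=
  ![[0, 1, 5], [0, 2, 8], [0, 3, 4], [1, 3, 9], [1, 4, 8], [1, 7], [2, 5, 9], [3, 5], [4, 5, 6, 7], [2, 3, 7], [2, 4], [3, 6, 8]]

theorem pt_inc {α : ℂ} (hα : α^4 + α^3 + α^2 + α + 1 = 0) (p : Fin 12) (k : Fin 10) :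
    ml α k (pt α p) = 0 ↔ k ∈ inc p := by
  fin_cases p <;> fin_cases k <;> simp [ml, form_apply, pt, inc] <;> try grind

noncomputable def gp (α : ℂ) : Fin 10 → Fin 3 → ℂ :=
  ![![1,2,0], ![0,1,2], ![1,2,-(α^2+α)+2*(α+1)], ![1,0,2], ![2,1,1], ![1,2,1], ![1,2,-α+2*(α+1)],
    ![1,2,-(α^2+α)+2*(α^2+α+1)], ![1,2,2-α], ![1,-α^3,2]]

theorem gp_inc {α : ℂ} (hα : α^4 + α^3 + α^2 + α + 1 = 0) (p k : Fin 10) :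
    ml α k (gp α p) = 0 ↔ k = p := by
  fin_cases p <;> fin_cases k <;> simp [ml, form_apply, gp] <;> try grind

theorem Tpt {α β : ℂ} (hα : α^4 + α^3 + α^2 + α + 1 = 0)
    {T : (Fin 3 → ℂ) → Fin 3 → ℂ} (hT : RelMap (ml α) (ml β) T) (p : Fin 12)
    (hp : p = 0 ∨ p = 2 ∨ p = 9) (l l' : Fin 10) (hl' : l' ∉ inc p) :
    ml β l (T (pt α p)) / ml β l' (T (pt α p)) = ml β l (pt β p) / ml β l' (pt β p) := by
  have hne : pt α p ≠ 0 := ne_zero_of_form (mt (pt_inc hα p l').1 hl')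
  have hT' : T (pt α p) ≠ 0 := ne_zero_of_form (hT.ne (mt (pt_inc hα p l').1 hl'))
  have key : ∀ k ∈ inc p, ml β k (T (pt α p)) = 0 := fun k hk =>
    (hT.zero_iff k _ hne).2 ((pt_inc hα p k).2 hk)
  generalize T (pt α p) = w at *
  obtain ⟨c, hc⟩ : ∃ c : ℂ, w = c • pt β p := by
    rcases hp with rfl | rfl | rfl
    · have h1 := key 0 (by decide)
      have h2 := key 1 (by decide)
      simp [ml, form_apply] at h1 h2
      refine ⟨w 1, ?_⟩
      ext i; fin_cases i <;> simp [pt, h1, h2]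
    · have h1 := key 0 (by decide)
      have h2 := key 3 (by decide)
      simp [ml, form_apply] at h1 h2
      refine ⟨w 0, ?_⟩
      ext i; fin_cases i <;> simp [pt, h1, h2]
    · have h1 := key 2 (by decide)
      have h2 := key 3 (by decide)
      simp [ml, form_apply] at h1 h2
      refine ⟨w 0, ?_⟩
      ext i; fin_cases i <;> simp [pt, h2]
      rw [h2] at h1
      linear_combination h1
  have hc0 : c ≠ 0 := by
    rintro rfl
    simp [hc] at hT'
  rw [hc, map_smul, map_smul, smul_eq_mul, smul_eq_mul, mul_div_mul_left _ _ hc0]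

/-- The rational function computed on the arrangement. -/
noncomputable def RR (α : ℂ) (p : Fin 12) (l l' : Fin 10) : ℂ :=
  ml α l (pt α p) / ml α l' (pt α p)

theorem RR_prod {α : ℂ} (hα : α^4 + α^3 + α^2 + α + 1 = 0) :
    RR α 0 2 7 * RR α 2 8 7 * RR α 0 7 9 * RR α 9 1 6 * RR α 2 9 1 * RR α 2 7 2 * RR α 2 6 8
      = α := by
  have h0 : α ≠ 0 := by grind
  have h1 : α + 1 ≠ 0 := by grind
  have h2 : α^2 + α + 1 ≠ 0 := by grind
  have h3 : α + -(α^2 + α) ≠ 0 := by grind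
  have h4 : α^2 + α ≠ 0 := by grind
  have h5 : -1 + -α ≠ 0 := by grind
  have h6 : -1 + -α + -α^2 ≠ 0 := by grind
  simp [RR, ml, form_apply, pt]
  field_simp
  grind

set_option synthInstance.maxSize 2000 in
set_option synthInstance.maxHeartbeats 200000 in
theorem tau_zero {Y : Fin 12 → Fin 10 → ℂ}
    (H : ∀ (k l l' : Fin 10) (p q : Fin 12),
      (((k, l, l') ∈ triples ∨ (l, k, l') ∈ triples ∨ (l, l', k) ∈ triples) ∧
       (k ∈ inc p ∧ l ∉ inc p ∧ l' ∉ inc p) ∧ (k ∈ inc q ∧ l ∉ inc q ∧ l' ∉ inc q)) →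
      Y p l - Y p l' = Y q l - Y q l') :
    (Y 0 2 - Y 0 7) + (Y 2 8 - Y 2 7) + (Y 0 7 - Y 0 9) + (Y 9 1 - Y 9 6) + (Y 2 9 - Y 2 1)
      + (Y 2 7 - Y 2 2) + (Y 2 6 - Y 2 8) = 0 := by
  linear_combination (1/5) * (
    (-1) * H 0 1 5 2 1 (by decide) +
    (-1) * H 1 0 5 5 4 (by decide) +
    (1) * H 5 0 1 7 6 (by decide) +
    (1) * H 5 0 1 8 6 (by decide) +
    (-2) * H 0 2 8 2 0 (by decide) +
    (-1) * H 2 0 8 10 9 (by decide) +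
    (1) * H 8 0 2 11 4 (by decide) +
    (1) * H 0 3 4 1 0 (by decide) +
    (-1) * H 3 0 4 7 3 (by decide) +
    (-1) * H 3 0 4 11 3 (by decide) +
    (-1) * H 4 0 3 8 10 (by decide) +
    (-1) * H 0 7 9 1 0 (by decide) +
    (-2) * H 0 7 9 2 0 (by decide) +
    (-1) * H 7 0 9 9 5 (by decide) +
    (2) * H 9 0 7 6 3 (by decide) +
    (-2) * H 1 2 6 3 0 (by decide) +
    (-1) * H 1 2 6 4 0 (by decide) +
    (1) * H 1 2 6 5 0 (by decide) +
    (-1) * H 2 1 6 10 9 (by decide) +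
    (-2) * H 2 1 6 6 9 (by decide) +
    (1) * H 6 1 2 8 11 (by decide) +
    (-1) * H 1 3 9 5 0 (by decide) +
    (2) * H 3 1 9 9 2 (by decide) +
    (1) * H 3 1 9 7 2 (by decide) +
    (2) * H 1 4 8 3 0 (by decide) +
    (1) * H 4 1 8 10 2 (by decide) +
    (1) * H 8 1 4 11 1 (by decide) +
    (1) * H 2 3 7 10 1 (by decide) +
    (2) * H 3 2 7 3 2 (by decide) +
    (1) * H 3 2 7 7 2 (by decide) +
    (1) * H 7 2 3 8 5 (by decide) +
    (-1) * H 2 5 9 9 1 (by decide) +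
    (-1) * H 5 2 9 7 0 (by decide) +
    (-2) * H 3 6 8 3 2 (by decide) +
    (-1) * H 3 6 8 9 2 (by decide) +
    (1) * H 4 5 6 4 2 (by decide) +
    (-1) * H 4 6 7 10 2 (by decide) +
    (-1) * H 5 4 7 7 0 (by decide) +
    (-2) * H 5 6 7 6 0 (by decide) +
    (1) * H 7 5 6 9 5 (by decide))

theorem main_alpha {α β : ℂ} (hα : α^4 + α^3 + α^2 + α + 1 = 0)
    (hβ : β^4 + β^3 + β^2 + β + 1 = 0) (h : CP2 ≃ₜ CP2)
    (hh : ∀ k, h '' Mline α k = Mline β k) : β = α ∨ α * β = 1 := by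
  have hne : ∀ {α : ℂ}, α^4 + α^3 + α^2 + α + 1 = 0 → ∀ a, ml α a ≠ 0 := by
    intro α hα a h0
    obtain ⟨b, hb⟩ := exists_ne a
    exact (mt (gp_inc hα b a).1 hb.symm) (by simp [h0])
  have hind : ∀ {α : ℂ}, α^4 + α^3 + α^2 + α + 1 = 0 → ∀ a b : Fin 10, a ≠ b →
      ∃ v, ml α a v = 0 ∧ ml α b v ≠ 0 := fun {α} hα a b hab =>
    ⟨gp α a, (gp_inc hα a a).2 rfl, mt (gp_inc hα a b).1 hab.symm⟩
  have hh' : ∀ k, h.symm '' Mline β k = Mline α k := fun k => by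
    rw [← hh k]; simp [image_image]
  have hT := relMap_Tmap h hh
  have hT' := relMap_Tmap h.symm hh'
  obtain ⟨d, hd⟩ := hT.degree (hne hα) (hind hα)
  obtain ⟨d', hd'⟩ := hT'.degree (hne hβ) (hind hβ)
  have hdd : d * d' = 1 := by
    obtain ⟨g, hg, hge⟩ := hd 0 1
    obtain ⟨g', hg', hge'⟩ := hd' 0 1
    exact hT.degree_mul hT' (Tmap_Tmap h) (k := 0) (l := 1) (by decide) (hne hα 0)
      (q := gp α 0) ⟨(gp_inc hα 0 0).2 rfl, fun a ha => mt (gp_inc hα 0 a).1 ha⟩ hg hg' hge hge'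
  choose g hg hge using fun l => hd l 0
  obtain ⟨X, hX⟩ := hT.exists_X (hne hα) 0 hg hge
  have htau := tau_zero (Y := fun p l => X (pt α p) l) (by
    rintro k l l' p q ⟨h1, ⟨h2, h3, h4⟩, h5, h6, h7⟩
    exact hT.X_const hX (conc hα k l l' h1) (conc hβ k l l' h1)
      ((pt_inc hα p k).2 h2) (mt (pt_inc hα p l).1 h3) (mt (pt_inc hα p l').1 h4)
      ((pt_inc hα q k).2 h5) (mt (pt_inc hα q l).1 h6) (mt (pt_inc hα q l').1 h7))
  have ev : ∀ (p : Fin 12) (l l' : Fin 10), (p = 0 ∨ p = 2 ∨ p = 9) ∧ l ∉ inc p ∧ l' ∉ inc p →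
      Complex.exp (X (pt α p) l - X (pt α p) l') * RR α p l l' ^ d = RR β p l l' := by
    rintro p l l' ⟨hp, h1, h2⟩
    have := (hX l l').2 (pt α p) (mt (pt_inc hα p l).1 h1) (mt (pt_inc hα p l').1 h2)
    rw [Tpt hα hT p hp l l' h2] at this
    exact this
  have key : α ^ d = β := by
    rw [← RR_prod hβ, ← ev 0 2 7 (by decide), ← ev 2 8 7 (by decide), ← ev 0 7 9 (by decide),
      ← ev 9 1 6 (by decide), ← ev 2 9 1 (by decide), ← ev 2 7 2 (by decide),
      ← ev 2 6 8 (by decide)]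
    have h1 : α ^ d = (RR α 0 2 7 * RR α 2 8 7 * RR α 0 7 9 * RR α 9 1 6 * RR α 2 9 1 * RR α 2 7 2
      * RR α 2 6 8) ^ d := by rw [RR_prod hα]
    rw [h1]
    simp only [mul_zpow]
    have h2 := congrArg Complex.exp htau
    rw [Complex.exp_zero] at h2
    simp only [Complex.exp_add] at h2
    linear_combination (-(RR α 0 2 7 ^ d * RR α 2 8 7 ^ d * RR α 0 7 9 ^ d * RR α 9 1 6 ^ d *
      RR α 2 9 1 ^ d * RR α 2 7 2 ^ d * RR α 2 6 8 ^ d)) * h2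
  have h0 : α ≠ 0 := by rintro rfl; simp at hα
  rcases Int.eq_one_or_neg_one_of_mul_eq_one hdd with rfl | rfl
  · left; simpa using key.symm
  · right; rw [← key]; simp [h0]

end Aux

/-- For `i ≠ j ∈ {1,2,3,4}` with `i + j ≢ 0 (mod 5)`, no homeomorphism of `ℂℙ²`
maps each line `L_k` of `M_i` onto the line `L_k` of `M_j`: the arrangements `M_i`
and `M_j` form an ordered Zariski pair. -/
theorem statement2 (ζ : ℂ) (hζ : ζ^4 + ζ^3 + ζ^2 + ζ + 1 = 0)
    (i j : ℕ) (hi : i ∈ Finset.Icc 1 4) (hj : j ∈ Finset.Icc 1 4)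
    (hij : i ≠ j) (hmod : ¬ (5 ∣ i + j)) :
    ¬ ∃ h : CP2 ≃ₜ CP2, ∀ k : Fin 10, h '' Mline (ζ^i) k = Mline (ζ^j) k := by
  rintro ⟨h, hh⟩
  have hp : ∀ i ∈ Finset.Icc 1 4, (ζ^i)^4 + (ζ^i)^3 + (ζ^i)^2 + ζ^i + 1 = 0 := by
    intro i hi
    rw [Finset.mem_Icc] at hi
    obtain ⟨h1, h2⟩ := hi
    interval_cases i <;> grind
  have := main_alpha (hp i hi) (hp j hj) h hh
  clear hh hp
  rw [Finset.mem_Icc] at hi hj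
  obtain ⟨h1, h2⟩ := hi
  obtain ⟨h3, h4⟩ := hj
  interval_cases i <;> interval_cases j <;> first | omega | grind
end
end
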